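/- Assume Hypotheses 1–3 and let V(x,y) := lim_{n→∞} (σ√(2πn)/2)·ℙ_x(τ_y > n). Then: (1) for every (x,y) ∈ 𝕏 × ℝ with V(x,y) > 0 and every t ≥ 0, ℙ_x( y+S_n ≤ tσ√n , τ_y > n ) / ℙ_x(τ_y > n) → 1 − e^{−t²/2} as n → ∞; (2) there exists ε₀ > 0 such that for every ε ∈ (0,ε₀) and every t₀ > 0 there is a constant c_{ε,t₀} > 0 with | ℙ_x( y+S_n ≤ tσ√n , τ_y > n ) − (2V(x,y)/(σ√(2πn)))·(1 − e^{−t²/2}) | ≤ c_{ε,t₀}·(1 + max(y,0)²)/n^{1/2+ε} for all n ≥ 1, t ∈ [0,t₀] and (x,y) ∈ 𝕏 × ℝ. -/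

import Mathlib

open Finset Filter Real Topology MeasureTheory

namespace CLLT

variable {X : Type*}

/-- Product of the transition weights along a path. -/
noncomputable def wt (P : X → X → ℝ) : X → List X → ℝ
  | _, [] => 1
  | x, y :: ys => P x y * wt P y ys

/-- Extension of a finite path `X₁, …, Xₙ` to a trajectory `ℕ → X` with `X₀ = x`
(values beyond time `n` are irrelevant and set to `x`). -/
def pathExt (x : X) {n : ℕ} (path : Fin n → X) : ℕ → X := fun k =>
  if h : 1 ≤ k ∧ k ≤ n then path ⟨k - 1, by omega⟩ else x

/-- Expectation `𝔼_x (F (X₀, X₁, …))` of a functional of the first `n` steps of the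
Markov chain with transition kernel `P` started at `X₀ = x`. -/
noncomputable def Ex [Fintype X] (P : X → X → ℝ) (x : X) (n : ℕ)
    (F : (ℕ → X) → ℝ) : ℝ :=
  ∑ path : Fin n → X, wt P x (List.ofFn path) * F (pathExt x path)

open Classical in
/-- Real-valued indicator of a proposition. -/
noncomputable def ind (p : Prop) : ℝ := if p then 1 else 0

/-- Partial sum `S_k = f(X₁) + ⋯ + f(X_k)` along a trajectory. -/
noncomputable def Spath (f : X → ℝ) (ω : ℕ → X) (k : ℕ) : ℝ :=
  ∑ i ∈ Finset.Icc 1 k, f (ω i)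

/-- The event `τ_y > n`, i.e. `y + S_k > 0` for all `k = 1, …, n`. -/
def survives (f : X → ℝ) (y : ℝ) (n : ℕ) (ω : ℕ → X) : Prop :=
  ∀ k ∈ Finset.Icc 1 n, 0 < y + Spath f ω k

/-- `n`-step transition kernel. -/
noncomputable def kpow [Fintype X] [DecidableEq X] (P : X → X → ℝ) : ℕ → X → X → ℝ
  | 0 => fun x x' => if x = x' then 1 else 0
  | n + 1 => fun x x' => ∑ y, P x y * kpow P n y x'

/-- Transition operator acting on functions. -/
noncomputable def Pop [Fintype X] (P : X → X → ℝ) (g : X → ℝ) (x : X) : ℝ :=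
  ∑ x', P x x' * g x'

/-- Asymptotic variance `σ² = ν(f²) + 2 ∑_{n ≥ 1} ν(f ⬝ Pⁿ f)`. -/
noncomputable def sigma2 [Fintype X] (P : X → X → ℝ) (ν f : X → ℝ) : ℝ :=
  (∑ x, f x ^ 2 * ν x) + 2 * ∑' n : ℕ, ∑ x, f x * ((Pop P)^[n + 1] f) x * ν x

/-- Hypothesis 1 (primitivity). -/
def Primitive [Fintype X] [DecidableEq X] (P : X → X → ℝ) : Prop :=
  ∃ k₀ : ℕ, 1 ≤ k₀ ∧ ∀ x x', 0 < kpow P k₀ x x'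

/-- Hypothesis 3 (non-lattice condition). -/
def NonLattice [Fintype X] (P : X → X → ℝ) (f : X → ℝ) : Prop :=
  ∀ θ a : ℝ, ∃ (n : ℕ) (g : Fin (n + 1) → X),
    (0 < ∏ i : Fin (n + 1), P (g i) (g (i + 1))) ∧
    ∀ m : ℤ, (∑ i, f (g i)) - (n + 1 : ℝ) * θ ≠ a * (m : ℝ)

/-- `P` is a stochastic matrix and `ν` is a positive invariant probability for it. -/
structure IsStochastic [Fintype X] (P : X → X → ℝ) (ν : X → ℝ) : Prop where
  nonneg : ∀ x x', 0 ≤ P x x'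
  rowSum : ∀ x, ∑ x', P x x' = 1
  nuPos : ∀ x, 0 < ν x
  nuSum : ∑ x, ν x = 1
  nuInv : ∀ x', ∑ x, ν x * P x x' = ν x'

/-- Dual kernel `P*(x, x') = ν(x') P(x', x) / ν(x)`. -/
noncomputable def dualK (P : X → X → ℝ) (ν : X → ℝ) (x x' : X) : ℝ :=
  ν x' * P x' x / ν x

/-- Sup norm of a function on a finite set. -/
noncomputable def supN [Fintype X] [Nonempty X] (ψ : X → ℝ) : ℝ := ⨆ x, |ψ x|

/-- Rayleigh density `φ₊(t) = t e^{-t²/2} 𝟙_{t ≥ 0}`. -/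
noncomputable def rayleigh (t : ℝ) : ℝ := if 0 ≤ t then t * Real.exp (-t ^ 2 / 2) else 0

/-- Centred normal density with standard deviation `s`. -/
noncomputable def gauss (s u : ℝ) : ℝ :=
  Real.exp (-u ^ 2 / (2 * s ^ 2)) / (s * Real.sqrt (2 * π))

/-- Perturbed transition operator `P_t`, as a complex matrix. -/
noncomputable def Pmat [Fintype X] (P : X → X → ℝ) (f : X → ℝ) (t : ℝ) : Matrix X X ℂ :=
  Matrix.of fun x x' => (P x x' : ℂ) * Complex.exp (Complex.I * (t : ℂ) * (f x' : ℂ))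

/-- A complex matrix viewed as a continuous linear operator on `X → ℂ`
(equipped with the sup norm). -/
noncomputable def toCLM [Fintype X] (M : Matrix X X ℂ) : (X → ℂ) →L[ℂ] (X → ℂ) :=
  LinearMap.toContinuousLinearMap M.mulVecLin

/-- Fourier transform `ĥ(t) = ∫ e^{-i t u} h(u) du`. -/
noncomputable def FT (h : ℝ → ℝ) (t : ℝ) : ℂ :=
  ∫ u : ℝ, Complex.exp (-(Complex.I * (t : ℂ) * (u : ℂ))) * (h u : ℂ)

/-- Convolution `(g ∗ k)(u) = ∫ g(v) k(u - v) dv`. -/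
noncomputable def convR (g k : ℝ → ℝ) (u : ℝ) : ℝ := ∫ v : ℝ, g v * k (u - v)

/-- Stone's kernel `κ`. -/
noncomputable def kapp (u : ℝ) : ℝ :=
  if u = 0 then 1 / (2 * π) else (Real.sin (u / 2) / (u / 2)) ^ 2 / (2 * π)

/-- Scaled kernel `κ_δ(u) = κ(u/δ)/δ`. -/
noncomputable def kappD (δ u : ℝ) : ℝ := kapp (u / δ) / δ

/-- Upper regularisation `h̄_ε(u) = sup_{v ∈ [u-ε, u+ε]} h(v)`. -/
noncomputable def upReg (h : ℝ → ℝ) (ε u : ℝ) : ℝ := sSup (h '' Set.Icc (u - ε) (u + ε))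

/-- Lower regularisation `ẖ_ε(u) = inf_{v ∈ [u-ε, u+ε]} h(v)`. -/
noncomputable def loReg (h : ℝ → ℝ) (ε u : ℝ) : ℝ := sInf (h '' Set.Icc (u - ε) (u + ε))

/-- The class `𝓗_ε`: non-negative, locally bounded, with `h`, `h̄_ε`, `ẖ_ε`
measurable and Lebesgue integrable. -/
def MemH (ε : ℝ) (h : ℝ → ℝ) : Prop :=
  (∀ u, 0 ≤ h u) ∧ (∀ K : Set ℝ, IsCompact K → BddAbove (h '' K)) ∧
  Measurable h ∧ Measurable (upReg h ε) ∧ Measurable (loReg h ε) ∧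
  Integrable h ∧ Integrable (upReg h ε) ∧ Integrable (loReg h ε)



/-- Killed transition operator. -/
noncomputable def Qop [Fintype X] (P : X → X → ℝ) (f : X → ℝ) (H : X → ℝ → ℝ) :
    X → ℝ → ℝ :=
  fun x y => ∑ x', P x x' * (if 0 < y + f x' then H x' (y + f x') else 0)

lemma pathExt_cons (x x' : X) {n : ℕ} (p : Fin n → X) (k : ℕ) (hk : k ≤ n) :
    pathExt x (Fin.cons x' p : Fin (n + 1) → X) (k + 1) = pathExt x' p k := by
  unfold pathExt
  rw [dif_pos (by omega)]
  rcases Nat.eq_zero_or_pos k with h | h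
  · subst h
    simp
  · rw [dif_pos (by omega)]
    obtain ⟨j, rfl⟩ : ∃ j, k = j + 1 := ⟨k - 1, by omega⟩
    have : (⟨j + 1 + 1 - 1, by omega⟩ : Fin (n + 1)) = Fin.succ ⟨j, by omega⟩ := by
      ext; simp
    rw [this, Fin.cons_succ]
    rfl

lemma Spath_cons (f : X → ℝ) (x x' : X) {n : ℕ} (p : Fin n → X) (k : ℕ) (hk : k ≤ n) :
    Spath f (pathExt x (Fin.cons x' p : Fin (n + 1) → X)) (k + 1)
      = f x' + Spath f (pathExt x' p) k := by
  induction k with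
  | zero => simp [Spath, pathExt]
  | succ k ih =>
    have h1 : ∀ ω : ℕ → X, ∀ j, Spath f ω (j + 1) = Spath f ω j + f (ω (j + 1)) := by
      intro ω j
      unfold Spath
      rw [Finset.sum_Icc_succ_top (by omega)]
    rw [h1, ih (by omega), h1 _ k, pathExt_cons x x' p (k + 1) hk]
    ring

lemma survives_cons (f : X → ℝ) (x x' : X) (y : ℝ) {n : ℕ} (p : Fin n → X) :
    survives f y (n + 1) (pathExt x (Fin.cons x' p : Fin (n + 1) → X)) ↔
      (0 < y + f x' ∧ survives f (y + f x') n (pathExt x' p)) := by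
  unfold survives
  constructor
  · intro h
    refine ⟨?_, ?_⟩
    · have := h (0 + 1) (by simp)
      rw [Spath_cons f x x' p 0 (by omega)] at this
      simpa [Spath] using this
    · intro k hk
      rw [Finset.mem_Icc] at hk
      have := h (k + 1) (by rw [Finset.mem_Icc]; omega)
      rw [Spath_cons f x x' p k hk.2] at this
      linarith
  · rintro ⟨h0, h⟩ k hk
    rw [Finset.mem_Icc] at hk
    obtain ⟨j, rfl⟩ : ∃ j, k = j + 1 := ⟨k - 1, by omega⟩
    rw [Spath_cons f x x' p j (by omega)]
    rcases Nat.eq_zero_or_pos j with hj | hj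
    · subst hj; simpa [Spath] using h0
    · have := h j (by rw [Finset.mem_Icc]; omega)
      linarith

lemma Ex_succ [Fintype X] (P : X → X → ℝ) (x : X) (n : ℕ) (F : (ℕ → X) → ℝ) :
    Ex P x (n + 1) F = ∑ x', P x x' * ∑ p : Fin n → X,
      wt P x' (List.ofFn p) * F (pathExt x (Fin.cons x' p : Fin (n + 1) → X)) := by
  unfold Ex
  rw [← (Fin.consEquiv (fun _ : Fin (n + 1) => X)).sum_comp, Fintype.sum_prod_type]
  refine Finset.sum_congr rfl fun x' _ => ?_
  rw [Finset.mul_sum]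
  refine Finset.sum_congr rfl fun p _ => ?_
  simp only [Fin.consEquiv, Equiv.coe_fn_mk, List.ofFn_succ, Fin.cons_zero, Fin.cons_succ, wt]
  ring

lemma Ex_eq_Q [Fintype X] (P : X → X → ℝ) (f : X → ℝ) (H : X → ℝ → ℝ) (n : ℕ) :
    ∀ (x : X) (y : ℝ),
    Ex P x n (fun ω => ind (survives f y n ω) * H (ω n) (y + Spath f ω n))
      = (Qop P f)^[n] H x y := by
  induction n with
  | zero =>
    intro x y
    simp [Ex, wt, pathExt, Spath, survives, ind]
  | succ n ih =>
    intro x y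
    rw [Ex_succ, Function.iterate_succ_apply', Qop]
    refine Finset.sum_congr rfl fun x' _ => ?_
    congr 1
    split_ifs with h
    · rw [← ih x' (y + f x')]
      unfold Ex
      refine Finset.sum_congr rfl fun p _ => ?_
      rw [survives_cons, Spath_cons f x x' p n le_rfl, pathExt_cons x x' p n le_rfl]
      simp only [h, true_and, add_assoc]
    · apply Finset.sum_eq_zero
      intro p _
      rw [survives_cons]
      simp [h, ind]




/-- Data extracted from the chain: the corrector `r`, the second corrector `ρ`, the variance. -/
structure Setup [Fintype X] (P : X → X → ℝ) (f r ρ : X → ℝ) (σ2 K : ℝ) : Prop where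
  nonneg : ∀ x x', 0 ≤ P x x'
  rowSum : ∀ x, ∑ x', P x x' = 1
  hr : ∀ x, ∑ x', P x x' * (f x' + r x') = r x
  hρ : ∀ x, ∑ x', P x x' * ((f x' + r x' - r x) ^ 2 + ρ x') = ρ x + σ2
  hσ : 0 < σ2
  hK : 1 ≤ K
  fK : ∀ x, |f x| ≤ K
  rK : ∀ x, |r x| ≤ K
  ρK : ∀ x, |ρ x| ≤ K

lemma Pop_iter_kpow [Fintype X] [DecidableEq X] (P : X → X → ℝ) (g : X → ℝ) (n : ℕ) :
    ∀ x, (Pop P)^[n] g x = ∑ x', kpow P n x x' * g x' := by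
  induction n with
  | zero => intro x; simp [kpow]
  | succ n ih =>
    intro x
    rw [Function.iterate_succ_apply', Pop]
    simp only [ih, kpow, Finset.sum_mul, Finset.mul_sum]
    rw [Finset.sum_comm]
    simp only [mul_assoc]

lemma nu_Pop [Fintype X] {P : X → X → ℝ} {ν : X → ℝ} (hS : IsStochastic P ν) (g : X → ℝ) :
    ∑ x, Pop P g x * ν x = ∑ x, g x * ν x := by
  simp only [Pop, Finset.sum_mul]
  rw [Finset.sum_comm]
  refine Finset.sum_congr rfl fun x' _ => ?_
  rw [← hS.nuInv x', Finset.mul_sum]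
  exact Finset.sum_congr rfl fun x _ => by ring

lemma nu_Pop_iter [Fintype X] {P : X → X → ℝ} {ν : X → ℝ} (hS : IsStochastic P ν) (g : X → ℝ)
    (n : ℕ) : ∑ x, (Pop P)^[n] g x * ν x = ∑ x, g x * ν x := by
  induction n with
  | zero => rfl
  | succ n ih => rw [Function.iterate_succ_apply', nu_Pop hS, ih]

lemma avg_abs_le [Fintype X] {P : X → X → ℝ} (hn : ∀ x x', 0 ≤ P x x')
    (hs : ∀ x, ∑ x', P x x' = 1) (x : X) (g : X → ℝ) (B : ℝ) (hB : ∀ x', |g x'| ≤ B) :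
    |∑ x', P x x' * g x'| ≤ B := by
  calc |∑ x', P x x' * g x'| ≤ ∑ x', |P x x' * g x'| := Finset.abs_sum_le_sum_abs _ _
    _ ≤ ∑ x', P x x' * B := by
        refine Finset.sum_le_sum fun x' _ => ?_
        rw [abs_mul, abs_of_nonneg (hn x x')]
        exact mul_le_mul_of_nonneg_left (hB x') (hn x x')
    _ = B := by rw [← Finset.sum_mul, hs, one_mul]

lemma kpow_sum [Fintype X] [DecidableEq X] {P : X → X → ℝ}
    (hs : ∀ x, ∑ x', P x x' = 1) (n : ℕ) : ∀ x, ∑ x', kpow P n x x' = 1 := by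
  induction n with
  | zero => intro x; simp [kpow]
  | succ n ih =>
    intro x
    simp only [kpow]
    rw [Finset.sum_comm]
    simp only [← Finset.mul_sum, ih, mul_one, hs]

lemma geo_bound [Fintype X] [DecidableEq X] [Nonempty X] {P : X → X → ℝ} {ν : X → ℝ}
    (hS : IsStochastic P ν) (h1 : Primitive P) :
    ∃ C a : ℝ, 0 ≤ C ∧ 0 < a ∧ a < 1 ∧ ∀ (g : X → ℝ) (B : ℝ), (∑ x, g x * ν x = 0) →
      (∀ x, |g x| ≤ B) → ∀ n x, |(Pop P)^[n] g x| ≤ C * B * a ^ n := by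
  obtain ⟨k, hk1, hk⟩ := h1
  obtain ⟨p0, -, hp0⟩ := Finset.exists_min_image (Finset.univ : Finset (X × X))
    (fun p => kpow P k p.1 p.2) Finset.univ_nonempty
  set δ : ℝ := min (kpow P k p0.1 p0.2) (1 / 2) with hδ
  have hδ0 : 0 < δ := lt_min (hk _ _) (by norm_num)
  have hδ1 : δ ≤ 1 / 2 := min_le_right _ _
  have hle : ∀ x x', δ * ν x' ≤ kpow P k x x' := by
    intro x x'
    have h1 : δ ≤ kpow P k x x' := (min_le_left _ _).trans (hp0 (x, x') (Finset.mem_univ _))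
    have h2 : ν x' ≤ 1 := by
      rw [← hS.nuSum]
      exact Finset.single_le_sum (f := ν) (fun i _ => (hS.nuPos i).le) (Finset.mem_univ x')
    nlinarith [hS.nuPos x']
  have contr : ∀ (g : X → ℝ) (B : ℝ), (∑ x, g x * ν x = 0) → (∀ x, |g x| ≤ B) →
      ∀ x, |(Pop P)^[k] g x| ≤ (1 - δ) * B := by
    intro g B hg hB x
    rw [Pop_iter_kpow]
    have : ∑ x', kpow P k x x' * g x' = ∑ x', (kpow P k x x' - δ * ν x') * g x' := by
      simp only [sub_mul, Finset.sum_sub_distrib]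
      have : ∑ x', δ * ν x' * g x' = δ * ∑ x, g x * ν x := by
        rw [Finset.mul_sum]; exact Finset.sum_congr rfl fun _ _ => by ring
      rw [this, hg]; ring
    rw [this]
    calc |∑ x', (kpow P k x x' - δ * ν x') * g x'|
        ≤ ∑ x', |(kpow P k x x' - δ * ν x') * g x'| := Finset.abs_sum_le_sum_abs _ _
      _ ≤ ∑ x', (kpow P k x x' - δ * ν x') * B := by
        refine Finset.sum_le_sum fun x' _ => ?_
        have h0 := sub_nonneg.2 (hle x x')
        rw [abs_mul, abs_of_nonneg h0]
        exact mul_le_mul_of_nonneg_left (hB x') h0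
      _ = (1 - δ) * B := by
        rw [← Finset.sum_mul, Finset.sum_sub_distrib, kpow_sum hS.rowSum, ← Finset.mul_sum,
          hS.nuSum, mul_one]
  have one : ∀ (g : X → ℝ) (B : ℝ), (∀ x, |g x| ≤ B) → ∀ n x, |(Pop P)^[n] g x| ≤ B := by
    intro g B hB n
    induction n with
    | zero => exact hB
    | succ n ih =>
      intro x
      rw [Function.iterate_succ_apply']
      exact avg_abs_le hS.nonneg hS.rowSum x _ B ih
  have many : ∀ (g : X → ℝ) (B : ℝ), (∑ x, g x * ν x = 0) → (∀ x, |g x| ≤ B) →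
      ∀ j x, |(Pop P)^[k * j] g x| ≤ (1 - δ) ^ j * B := by
    intro g B hg hB j
    induction j with
    | zero => simpa using hB
    | succ j ih =>
      intro x
      have e : k * (j + 1) = k + k * j := by ring
      rw [e, Function.iterate_add_apply]
      have := contr ((Pop P)^[k * j] g) _ (by rw [nu_Pop_iter hS]; exact hg) ih x
      calc _ ≤ _ := this
        _ = _ := by ring
  set q := 1 - δ with hq
  have hq0 : 0 < q := by rw [hq]; linarith
  set a : ℝ := q ^ ((k : ℝ)⁻¹) with ha
  have hk0 : k ≠ 0 := by omega
  have hak : a ^ k = q := Real.rpow_inv_natCast_pow hq0.le hk0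
  have ha0 : 0 < a := Real.rpow_pos_of_pos hq0 _
  have ha1 : a < 1 := Real.rpow_lt_one hq0.le (by rw [hq]; linarith) (by positivity)
  refine ⟨1 / q, a, by positivity, ha0, ha1, ?_⟩
  intro g B hg hB n x
  have hB0 : 0 ≤ B := (abs_nonneg _).trans (hB x)
  have e : n = n % k + k * (n / k) := (Nat.mod_add_div n k).symm
  have e2 : (Pop P)^[n] g x = (Pop P)^[n % k] ((Pop P)^[k * (n / k)] g) x := by
    rw [← Function.iterate_add_apply, ← e]
  rw [e2]
  refine (one _ _ (many g B hg hB (n / k)) _ x).trans ?_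
  have h3 : q ≤ a ^ (n % k) := by
    rw [← hak]
    exact pow_le_pow_of_le_one ha0.le ha1.le (Nat.mod_lt n (by omega)).le
  have h4 : a ^ n = a ^ (n % k) * q ^ (n / k) := by
    conv_lhs => rw [e, pow_add, pow_mul, hak]
  rw [h4]
  have h5 : 1 ≤ 1 / q * a ^ (n % k) := by
    rw [div_mul_eq_mul_div, one_mul, le_div_iff₀ hq0]; linarith
  have h6 : 0 ≤ q ^ (n / k) * B := by positivity
  calc q ^ (n / k) * B ≤ (1 / q * a ^ (n % k)) * (q ^ (n / k) * B) := by nlinarith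
    _ = _ := by ring

lemma poisson [Fintype X] [DecidableEq X] [Nonempty X] {P : X → X → ℝ} {ν : X → ℝ}
    (hS : IsStochastic P ν) (h1 : Primitive P) (g : X → ℝ) (hg : ∑ x, g x * ν x = 0) :
    (∀ x, Summable fun n => (Pop P)^[n] g x) ∧
    ∀ x, (∑' n, (Pop P)^[n] g x) = g x + Pop P (fun x => ∑' n, (Pop P)^[n] g x) x := by
  obtain ⟨C, a, hC, ha0, ha1, H⟩ := geo_bound hS h1
  obtain ⟨B, hB⟩ : ∃ B, ∀ x, |g x| ≤ B := by
    refine ⟨∑ x, |g x|, fun x => ?_⟩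
    exact Finset.single_le_sum (f := fun x => |g x|) (fun i _ => abs_nonneg _) (Finset.mem_univ x)
  have hs : ∀ x, Summable fun n => (Pop P)^[n] g x := by
    intro x
    refine Summable.of_norm_bounded (g := fun n => C * B * a ^ n)
      ((summable_geometric_of_lt_one ha0.le ha1).mul_left _) (fun n => H g B hg hB n x)
  refine ⟨hs, fun x => ?_⟩
  rw [(hs x).tsum_eq_zero_add]
  simp only [Function.iterate_zero, id]
  congr 1
  simp only [Function.iterate_succ_apply', Pop]
  rw [Summable.tsum_finsetSum (fun i _ => (hs i).mul_left _)]
  exact Finset.sum_congr rfl fun i _ => tsum_mul_left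

lemma exists_setup [Fintype X] [DecidableEq X] [Nonempty X] (P : X → X → ℝ) (ν f : X → ℝ)
    (hS : IsStochastic P ν) (h1 : Primitive P) (h2 : ∑ x, f x * ν x = 0)
    (h3 : NonLattice P f) : ∃ r ρ K, Setup P f r ρ (sigma2 P ν f) K := by
  obtain ⟨hs, hR⟩ := poisson hS h1 f h2
  set R : X → ℝ := fun x => ∑' n, (Pop P)^[n] f x with hRdef
  set r : X → ℝ := fun x => Pop P R x with hr
  have hfr : ∀ x, f x + r x = R x := fun x => (hR x).symm
  have hr' : ∀ x, ∑ x', P x x' * (f x' + r x') = r x := by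
    intro x; simp only [hfr]; rfl
  set v : X → ℝ := fun x => ∑ x', P x x' * (f x' + r x' - r x) ^ 2 with hv
  have hv2 : ∀ x, v x = Pop P (fun x => R x ^ 2) x - r x ^ 2 := by
    intro x
    have : ∀ x', P x x' * (f x' + r x' - r x) ^ 2
        = P x x' * R x' ^ 2 - 2 * r x * (P x x' * R x') + r x ^ 2 * P x x' := by
      intro x'; rw [hfr]; ring
    simp only [hv, this, Finset.sum_add_distrib, Finset.sum_sub_distrib, ← Finset.mul_sum,
      hS.rowSum]
    have e : ∑ x', P x x' * R x' = r x := rfl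
    rw [e]
    simp only [Pop]
    ring
  have hrs : ∀ x, r x = ∑' n, (Pop P)^[n + 1] f x := by
    intro x
    have := (hs x).tsum_eq_zero_add
    have h5 := hR x
    simp only [Function.iterate_zero, id] at this
    have h6 : R x = f x + ∑' n, (Pop P)^[n + 1] f x := this
    have h7 : R x = f x + r x := h5
    linarith
  have hσ : sigma2 P ν f = ∑ x, v x * ν x := by
    have e1 : ∑ x, v x * ν x = ∑ x, R x ^ 2 * ν x - ∑ x, r x ^ 2 * ν x := by
      rw [← nu_Pop hS (fun x => R x ^ 2), ← Finset.sum_sub_distrib]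
      exact Finset.sum_congr rfl fun x _ => by rw [hv2]; ring
    have e2 : ∑' n : ℕ, ∑ x, f x * ((Pop P)^[n + 1] f) x * ν x = ∑ x, f x * r x * ν x := by
      have hs' : ∀ x, Summable fun n => (Pop P)^[n + 1] f x := fun x =>
        (summable_nat_add_iff 1).2 (hs x)
      rw [Summable.tsum_finsetSum (fun i _ => ((hs' i).mul_left _).mul_right _)]
      refine Finset.sum_congr rfl fun i _ => ?_
      rw [tsum_mul_right, tsum_mul_left, ← hrs]
    rw [e1, sigma2, e2, Finset.mul_sum, ← Finset.sum_add_distrib, ← Finset.sum_sub_distrib]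
    exact Finset.sum_congr rfl fun x _ => by rw [← hfr]; ring
  have hv0 : ∀ x, 0 ≤ v x := fun x =>
    Finset.sum_nonneg fun x' _ => mul_nonneg (hS.nonneg x x') (sq_nonneg _)
  have hσ0 : 0 ≤ sigma2 P ν f := by
    rw [hσ]; exact Finset.sum_nonneg fun x _ => mul_nonneg (hv0 x) (hS.nuPos x).le
  have hσpos : 0 < sigma2 P ν f := by
    refine lt_of_le_of_ne hσ0 fun h0 => ?_
    rw [hσ] at h0
    have hz := (Finset.sum_eq_zero_iff_of_nonneg
      (fun x _ => mul_nonneg (hv0 x) (hS.nuPos x).le)).1 h0.symm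
    have hz' : ∀ x, v x = 0 := fun x =>
      (mul_eq_zero.1 (hz x (Finset.mem_univ x))).resolve_right (hS.nuPos x).ne'
    have hstep : ∀ x x', 0 < P x x' → f x' = r x - r x' := by
      intro x x' hp
      have := (Finset.sum_eq_zero_iff_of_nonneg
        (fun x' _ => mul_nonneg (hS.nonneg x x') (sq_nonneg _))).1 (hz' x) x' (Finset.mem_univ x')
      have := (mul_eq_zero.1 this).resolve_left hp.ne'
      have := pow_eq_zero_iff (two_ne_zero) |>.1 this
      linarith
    obtain ⟨n, g, hg, hm⟩ := h3 0 0
    have hpos : ∀ i, 0 < P (g i) (g (i + 1)) := by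
      intro i
      refine lt_of_le_of_ne (hS.nonneg _ _) fun h => ?_
      rw [Finset.prod_eq_zero (Finset.mem_univ i) h.symm] at hg
      exact lt_irrefl _ hg
    apply hm 0
    have e1 : ∑ i, f (g i) = ∑ i, f (g (i + 1)) :=
      (Equiv.sum_comp (Equiv.addRight (1 : Fin (n + 1))) (fun i => f (g i))).symm
    have e2 : ∑ i, r (g i) = ∑ i, r (g (i + 1)) :=
      (Equiv.sum_comp (Equiv.addRight (1 : Fin (n + 1))) (fun i => r (g i))).symm
    have e3 : ∑ i, f (g (i + 1)) = ∑ i, (r (g i) - r (g (i + 1))) :=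
      Finset.sum_congr rfl fun i _ => hstep _ _ (hpos i)
    rw [e1, e3, Finset.sum_sub_distrib, e2]
    simp
  have hgc : ∑ x, (v x - sigma2 P ν f) * ν x = 0 := by
    simp only [sub_mul, Finset.sum_sub_distrib, ← Finset.mul_sum, hS.nuSum]
    rw [hσ]; ring
  obtain ⟨-, hρ⟩ := poisson hS h1 (fun x => v x - sigma2 P ν f) hgc
  set ρ : X → ℝ := fun x => ∑' n, (Pop P)^[n] (fun x => v x - sigma2 P ν f) x with hρdef
  have hsingle : ∀ (g : X → ℝ) x, |g x| ≤ ∑ x, |g x| := fun g x =>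
    Finset.single_le_sum (f := fun x => |g x|) (fun i _ => abs_nonneg _) (Finset.mem_univ x)
  have hnn : ∀ (g : X → ℝ), 0 ≤ ∑ x, |g x| := fun g => Finset.sum_nonneg fun _ _ => abs_nonneg _
  refine ⟨r, ρ, 1 + ∑ x, |f x| + ∑ x, |r x| + ∑ x, |ρ x|,
    ⟨hS.nonneg, hS.rowSum, hr', ?_, hσpos, ?_, ?_, ?_, ?_⟩⟩
  · intro x
    have : ρ x = v x - sigma2 P ν f + Pop P ρ x := hρ x
    simp only [mul_add, Finset.sum_add_distrib]
    have e : ∑ x', P x x' * ρ x' = Pop P ρ x := rfl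
    have e' : ∑ x', P x x' * (f x' + r x' - r x) ^ 2 = v x := rfl
    rw [e, e']
    linarith
  · linarith [hnn f, hnn r, hnn ρ]
  · intro x; linarith [hnn f, hnn r, hnn ρ, hsingle f x]
  · intro x; linarith [hnn f, hnn r, hnn ρ, hsingle r x]
  · intro x; linarith [hnn f, hnn r, hnn ρ, hsingle ρ x]




/-- The killed operator as a linear map. -/
noncomputable def Tl [Fintype X] (P : X → X → ℝ) (f : X → ℝ) :
    Module.End ℝ (X → ℝ → ℝ) where
  toFun := Qop P f
  map_add' H1 H2 := by
    funext x y
    simp only [Qop, Pi.add_apply, ← Finset.sum_add_distrib, ← mul_add]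
    refine Finset.sum_congr rfl fun x' _ => ?_
    split_ifs <;> simp
  map_smul' c H := by
    funext x y
    simp only [Qop, Pi.smul_apply, smul_eq_mul, RingHom.id_apply, Finset.mul_sum]
    refine Finset.sum_congr rfl fun x' _ => ?_
    split_ifs
    · ring
    · simp

/-- Exit operator. -/
noncomputable def Bop [Fintype X] (P : X → X → ℝ) (f : X → ℝ) (H : X → ℝ → ℝ) :
    X → ℝ → ℝ :=
  fun x y => ∑ x', P x x' * (if 0 < y + f x' then 0 else H x' (y + f x'))

/-- Free operator. -/
noncomputable def Fop [Fintype X] (P : X → X → ℝ) (f : X → ℝ) (H : X → ℝ → ℝ) :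
    X → ℝ → ℝ :=
  fun x y => ∑ x', P x x' * H x' (y + f x')

lemma Fop_eq [Fintype X] (P : X → X → ℝ) (f : X → ℝ) (H : X → ℝ → ℝ) :
    Fop P f H = Tl P f H + Bop P f H := by
  funext x y
  simp only [Fop, Tl, Bop, Qop, LinearMap.coe_mk, AddHom.coe_mk, Pi.add_apply,
    ← Finset.sum_add_distrib, ← mul_add]
  refine Finset.sum_congr rfl fun x' _ => ?_
  split_ifs <;> simp

lemma Tl_pow_apply [Fintype X] (P : X → X → ℝ) (f : X → ℝ) (n : ℕ) (H : X → ℝ → ℝ) :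
    (Tl P f ^ n) H = (Qop P f)^[n] H := by
  rw [Module.End.pow_apply]; rfl

section
variable [Fintype X] {P : X → X → ℝ} {f r ρ : X → ℝ} {σ2 K : ℝ}

lemma Tl_mono_pos (S : Setup P f r ρ σ2 K) {H1 H2 : X → ℝ → ℝ}
    (h : ∀ x y, 0 < y → H1 x y ≤ H2 x y) (x : X) (y : ℝ) : Tl P f H1 x y ≤ Tl P f H2 x y := by
  simp only [Tl, Qop, LinearMap.coe_mk, AddHom.coe_mk]
  refine Finset.sum_le_sum fun x' _ => mul_le_mul_of_nonneg_left ?_ (S.nonneg x x')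
  split_ifs with hy
  · exact h _ _ hy
  · exact le_rfl

lemma Tn_mono (S : Setup P f r ρ σ2 K) {H1 H2 : X → ℝ → ℝ}
    (h : ∀ x y, -K ≤ y → H1 x y ≤ H2 x y) (n : ℕ) :
    ∀ x y, -K ≤ y → (Tl P f ^ n) H1 x y ≤ (Tl P f ^ n) H2 x y := by
  induction n with
  | zero => simpa using h
  | succ n ih =>
    intro x y _
    rw [pow_succ', Module.End.mul_apply, Module.End.mul_apply]
    exact Tl_mono_pos S (fun x y hy => ih x y (by linarith [S.hK])) x y

lemma Tn_mono_pos (S : Setup P f r ρ σ2 K) {H1 H2 : X → ℝ → ℝ}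
    (h : ∀ x y, 0 < y → H1 x y ≤ H2 x y) (n : ℕ) (hn : 1 ≤ n) :
    ∀ x y, (Tl P f ^ n) H1 x y ≤ (Tl P f ^ n) H2 x y := by
  induction n, hn using Nat.le_induction with
  | base => simpa using Tl_mono_pos S h
  | succ n _ ih =>
    intro x y
    rw [pow_succ', Module.End.mul_apply, Module.End.mul_apply]
    exact Tl_mono_pos S (fun x y _ => ih x y) x y

lemma Tn_abs (S : Setup P f r ρ σ2 K) {H1 H2 : X → ℝ → ℝ}
    (h : ∀ x y, -K ≤ y → |H1 x y| ≤ H2 x y) (n : ℕ) (x : X) (y : ℝ) (hy : -K ≤ y) :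
    |(Tl P f ^ n) H1 x y| ≤ (Tl P f ^ n) H2 x y := by
  rw [abs_le]
  constructor
  · have := Tn_mono S (H1 := -H2) (H2 := H1) (fun x y hy => (abs_le.1 (h x y hy)).1) n x y hy
    rw [map_neg] at this
    exact this
  · exact Tn_mono S (fun x y hy => (abs_le.1 (h x y hy)).2) n x y hy

lemma Tn_nonneg (S : Setup P f r ρ σ2 K) {H : X → ℝ → ℝ}
    (h : ∀ x y, -K ≤ y → 0 ≤ H x y) (n : ℕ) (x : X) (y : ℝ) (hy : -K ≤ y) :
    0 ≤ (Tl P f ^ n) H x y := by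
  have := Tn_mono S (H1 := 0) (H2 := H) h n x y hy
  simpa using this

lemma T_one_le (S : Setup P f r ρ σ2 K) (x : X) (y : ℝ) : Tl P f 1 x y ≤ 1 := by
  rw [← S.rowSum x]
  simp only [Tl, Qop, LinearMap.coe_mk, AddHom.coe_mk]
  refine Finset.sum_le_sum fun x' _ => ?_
  have := S.nonneg x x'
  split_ifs <;> simp [this]

lemma Tn_one_succ (S : Setup P f r ρ σ2 K) (n : ℕ) (x : X) (y : ℝ) (hy : -K ≤ y) :
    (Tl P f ^ (n + 1)) 1 x y ≤ (Tl P f ^ n) 1 x y := by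
  rw [pow_succ, Module.End.mul_apply]
  exact Tn_mono S (fun x y _ => T_one_le S x y) n x y hy

lemma Tn_one_anti (S : Setup P f r ρ σ2 K) {m n : ℕ} (hmn : m ≤ n) (x : X) (y : ℝ)
    (hy : -K ≤ y) : (Tl P f ^ n) 1 x y ≤ (Tl P f ^ m) 1 x y := by
  induction n, hmn using Nat.le_induction with
  | base => exact le_rfl
  | succ n _ ih => exact (Tn_one_succ S n x y hy).trans ih

lemma Tn_one_le_one (S : Setup P f r ρ σ2 K) (n : ℕ) (x : X) (y : ℝ) (hy : -K ≤ y) :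
    (Tl P f ^ n) 1 x y ≤ 1 := by
  simpa using Tn_one_anti S (Nat.zero_le n) x y hy

lemma Tn_one_nonneg (S : Setup P f r ρ σ2 K) (n : ℕ) (x : X) (y : ℝ) (hy : -K ≤ y) :
    0 ≤ (Tl P f ^ n) 1 x y := Tn_nonneg S (fun _ _ _ => zero_le_one) n x y hy

/-- The generator estimate. -/
lemma generator (S : Setup P f r ρ σ2 K) (φ φ2 : ℝ → ℝ) (φ1 z A : ℝ) (x : X)
    (h0 : ∀ d, |d| ≤ 3 * K → |φ (z + d) - φ z - φ1 * d - φ2 z * d ^ 2 / 2| ≤ A)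
    (h2 : ∀ d, |d| ≤ 3 * K → |φ2 (z + d) - φ2 z| ≤ A) :
    |∑ x', P x x' * (φ (z + (f x' + r x' - r x)) + ρ x' / 2 * φ2 (z + (f x' + r x' - r x)))
      - (φ z + ρ x / 2 * φ2 z) - σ2 / 2 * φ2 z| ≤ 2 * K * A := by
  have hd : ∀ x', |f x' + r x' - r x| ≤ 3 * K := by
    intro x'
    have a := abs_le.1 (S.fK x'); have b := abs_le.1 (S.rK x'); have c := abs_le.1 (S.rK x)
    rw [abs_le]; constructor <;> linarith
  have hA : 0 ≤ A := (abs_nonneg _).trans (h2 0 (by simp; linarith [S.hK]))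
  have key : ∑ x', P x x' * (φ (z + (f x' + r x' - r x)) + ρ x' / 2 * φ2 (z + (f x' + r x' - r x)))
      - (φ z + ρ x / 2 * φ2 z) - σ2 / 2 * φ2 z
      = ∑ x', P x x' * ((φ (z + (f x' + r x' - r x)) - φ z - φ1 * (f x' + r x' - r x)
          - φ2 z * (f x' + r x' - r x) ^ 2 / 2)
        + ρ x' / 2 * (φ2 (z + (f x' + r x' - r x)) - φ2 z)) := by
    have e : ∀ x', P x x' * ((φ (z + (f x' + r x' - r x)) - φ z - φ1 * (f x' + r x' - r x)
          - φ2 z * (f x' + r x' - r x) ^ 2 / 2)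
        + ρ x' / 2 * (φ2 (z + (f x' + r x' - r x)) - φ2 z))
        = P x x' * (φ (z + (f x' + r x' - r x)) + ρ x' / 2 * φ2 (z + (f x' + r x' - r x)))
          - (φ z - φ1 * r x) * P x x' - φ1 * (P x x' * (f x' + r x'))
          - φ2 z / 2 * (P x x' * ((f x' + r x' - r x) ^ 2 + ρ x')) := by
      intro x'; ring
    simp only [e, Finset.sum_sub_distrib, ← Finset.mul_sum, S.rowSum, S.hr, S.hρ]
    ring
  rw [key]
  refine avg_abs_le S.nonneg S.rowSum x _ _ fun x' => ?_
  have a := h0 _ (hd x')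
  have b := h2 _ (hd x')
  have c : |ρ x' / 2| ≤ K := by
    rw [abs_div, abs_two]; linarith [S.ρK x', S.hK]
  calc _ ≤ _ := abs_add_le _ _
    _ ≤ A + K * A := by
      rw [abs_mul]
      exact add_le_add a (mul_le_mul c b (abs_nonneg _) (by linarith [S.hK]))
    _ ≤ 2 * K * A := by nlinarith [S.hK]

/-- Auxiliary exponential weight. -/
noncomputable def eW (r : X → ℝ) (K h : ℝ) : X → ℝ → ℝ :=
  fun x y => Real.exp (-(y + r x + 4 * K) / h)

/-- Supersolution. -/
noncomputable def WW (r ρ : X → ℝ) (K h : ℝ) : X → ℝ → ℝ :=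
  fun x y => h ^ 2 * (1 - eW r K h x y) - ρ x / 2 * eW r K h x y + K

lemma WW_lower (S : Setup P f r ρ σ2 K) {h : ℝ} (hh : 0 < h) (x : X) (y : ℝ) (hy : -(2 * K) ≤ y) :
    h ^ 2 * (1 - eW r K h x y) ≤ WW r ρ K h x y ∧ eW r K h x y ≤ 1 := by
  have e1 : eW r K h x y ≤ 1 := by
    unfold eW
    rw [Real.exp_le_one_iff]
    apply div_nonpos_of_nonpos_of_nonneg _ hh.le
    linarith [(abs_le.1 (S.rK x)).1, S.hK]
  have e0 : 0 < eW r K h x y := Real.exp_pos _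
  refine ⟨?_, e1⟩
  have a := abs_le.1 (S.ρK x)
  unfold WW
  nlinarith [S.hK]

lemma WW_upper (S : Setup P f r ρ σ2 K) {h : ℝ} (hh : 1 ≤ h) (x : X) (y : ℝ) (hy : -(2 * K) ≤ y) :
    WW r ρ K h x y ≤ 7 * K * h * (1 + max y 0) := by
  have e0 : 0 < eW r K h x y := Real.exp_pos _
  have e1 := (WW_lower S (by linarith : 0 < h) x y hy).2
  have a := abs_le.1 (S.ρK x)
  have hl : 1 - eW r K h x y ≤ (y + r x + 4 * K) / h := by
    have := Real.add_one_le_exp (-(y + r x + 4 * K) / h)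
    unfold eW
    rw [neg_div] at this ⊢
    linarith
  have h2 : h ^ 2 * (1 - eW r K h x y) ≤ h * (y + r x + 4 * K) := by
    calc h ^ 2 * (1 - eW r K h x y) ≤ h ^ 2 * ((y + r x + 4 * K) / h) := by gcongr
      _ = _ := by field_simp
  have b := (abs_le.1 (S.rK x)).2
  have hm := le_max_left y 0
  have hm0 := le_max_right y 0
  have hK := S.hK
  have h3 : - ρ x / 2 * eW r K h x y ≤ K := by nlinarith
  have h4 : h * (y + r x + 4 * K) ≤ h * (max y 0 + 5 * K) :=
    mul_le_mul_of_nonneg_left (by linarith) (by linarith)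
  have h5 : max y 0 ≤ K * max y 0 := by nlinarith
  have h6 : h * (max y 0) ≤ h * (K * max y 0) := by gcongr
  have h7 : 0 ≤ h * (K * max y 0) := by positivity
  have h8 : K ≤ K * h := by nlinarith
  unfold WW
  nlinarith

lemma exp_taylor3 (a : ℝ) (ha : |a| ≤ 1) : |Real.exp (-a) - 1 + a - a ^ 2 / 2| ≤ |a| ^ 3 := by
  have := Real.exp_bound (x := -a) (by simpa using ha) (n := 3) (by norm_num)
  simp only [Finset.sum_range_succ, Finset.sum_range_zero] at this
  norm_num [Nat.factorial] at this
  have e : Real.exp (-a) - 1 + a - a ^ 2 / 2 = Real.exp (-a) - (1 + -a + a ^ 2 / 2) := by ring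
  rw [e]
  refine this.trans ?_
  have := pow_nonneg (abs_nonneg a) 3
  linarith

lemma WW_step (S : Setup P f r ρ σ2 K) : ∃ h0, 1 ≤ h0 ∧ ∀ h, h0 ≤ h → ∀ x y, -K ≤ y →
    Tl P f (WW r ρ K h) x y + σ2 / 4 * eW r K h x y ≤ WW r ρ K h x y := by
  have hK := S.hK
  have hσ := S.hσ
  refine ⟨216 * K ^ 4 / σ2 + 3 * K, ?_, ?_⟩
  · have : 0 ≤ 216 * K ^ 4 / σ2 := by positivity
    linarith
  intro h hh x y hy
  have hp : 0 ≤ 216 * K ^ 4 / σ2 := by positivity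
  have hh3 : 3 * K ≤ h := by linarith
  have h0 : 0 < h := by linarith
  have hh2 : 216 * K ^ 4 ≤ σ2 * h := by
    have : 216 * K ^ 4 / σ2 ≤ h := by linarith
    rw [div_le_iff₀ hσ] at this
    linarith
  set z := y + r x + 4 * K with hz
  set E := Real.exp (-z / h) with hE
  have hE0 : 0 < E := Real.exp_pos _
  have hsplit : ∀ d, Real.exp (-(z + d) / h) = E * Real.exp (-(d / h)) := by
    intro d; rw [hE, ← Real.exp_add]; congr 1; ring
  have g := generator S (fun z => -h ^ 2 * Real.exp (-z / h)) (fun z => - Real.exp (-z / h))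
    (h * E) z (27 * K ^ 3 * E / h) x ?_ ?_
  · have hF : Fop P f (WW r ρ K h) x y = ∑ x', P x x' *
        (-h ^ 2 * Real.exp (-(z + (f x' + r x' - r x)) / h)
          + ρ x' / 2 * (- Real.exp (-(z + (f x' + r x' - r x)) / h))) + (h ^ 2 + K) := by
      have e1 : h ^ 2 + K = ∑ x', P x x' * (h ^ 2 + K) := by
        rw [← Finset.sum_mul, S.rowSum, one_mul]
      rw [e1, ← Finset.sum_add_distrib]
      unfold Fop
      refine Finset.sum_congr rfl fun x' _ => ?_
      have e2 : z + (f x' + r x' - r x) = y + f x' + r x' + 4 * K := by rw [hz]; ring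
      rw [e2]
      unfold WW eW
      ring
    have hB : 0 ≤ Bop P f (WW r ρ K h) x y := by
      refine Finset.sum_nonneg fun x' _ => mul_nonneg (S.nonneg x x') ?_
      split_ifs
      · exact le_rfl
      · have hy' : -(2 * K) ≤ y + f x' := by linarith [(abs_le.1 (S.fK x')).1]
        obtain ⟨a, b⟩ := WW_lower S h0 x' _ hy'
        refine le_trans ?_ a
        have : 0 ≤ 1 - eW r K h x' (y + f x') := by linarith
        positivity
    have hdec : Fop P f (WW r ρ K h) x y
        = Tl P f (WW r ρ K h) x y + Bop P f (WW r ρ K h) x y := by rw [Fop_eq]; rfl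
    have hWxy : WW r ρ K h x y = h ^ 2 + K - h ^ 2 * E - ρ x / 2 * E := by
      unfold WW eW; rw [← hz, ← hE]; ring
    have heW : eW r K h x y = E := rfl
    have hA : 2 * K * (27 * K ^ 3 * E / h) ≤ σ2 / 4 * E := by
      rw [mul_div_assoc', div_le_iff₀ h0]
      nlinarith
    have g' := (abs_le.1 g).2
    rw [← hE] at g'
    rw [heW, hWxy]
    linarith
  · intro d hd
    have hdh : |d / h| ≤ 1 := by
      rw [abs_div, abs_of_pos h0, div_le_one h0]; linarith
    have t := exp_taylor3 _ hdh
    simp only [hsplit]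
    have e : -h ^ 2 * (E * Real.exp (-(d / h))) - -h ^ 2 * E - h * E * d - -E * d ^ 2 / 2
        = -(h ^ 2 * E) * (Real.exp (-(d / h)) - 1 + d / h - (d / h) ^ 2 / 2) := by
      field_simp; ring
    rw [← hE, e, abs_mul, abs_neg, abs_of_pos (by positivity)]
    have hd3 : |d| ^ 3 ≤ (3 * K) ^ 3 := pow_le_pow_left₀ (abs_nonneg _) hd 3
    calc h ^ 2 * E * |Real.exp (-(d / h)) - 1 + d / h - (d / h) ^ 2 / 2|
        ≤ h ^ 2 * E * |d / h| ^ 3 := by gcongr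
      _ = E * |d| ^ 3 / h := by rw [abs_div, abs_of_pos h0]; field_simp
      _ ≤ E * (3 * K) ^ 3 / h := by gcongr
      _ = _ := by ring
  · intro d hd
    have hdh : |d / h| ≤ 1 := by
      rw [abs_div, abs_of_pos h0, div_le_one h0]; linarith
    have t := Real.abs_exp_sub_one_le (x := -(d / h)) (by rwa [abs_neg])
    simp only [hsplit]
    have e : -(E * Real.exp (-(d / h))) - -E = -E * (Real.exp (-(d / h)) - 1) := by ring
    rw [← hE, e, abs_mul, abs_neg, abs_of_pos hE0]
    have hK2 : 6 * K ≤ 27 * K ^ 3 := by nlinarith [mul_self_nonneg (K - 1), mul_pos (by linarith : 0 < K) (by linarith : 0 < K)]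
    calc E * |Real.exp (-(d / h)) - 1| ≤ E * (2 * |-(d / h)|) := by gcongr
      _ = E * (2 * |d|) / h := by rw [abs_neg, abs_div, abs_of_pos h0]; ring
      _ ≤ E * (2 * (3 * K)) / h := by gcongr
      _ ≤ E * (27 * K ^ 3) / h := by
        apply div_le_div_of_nonneg_right _ h0.le
        exact mul_le_mul_of_nonneg_left (by linarith) hE0.le
      _ = _ := by ring

/-- Crude bound on the survival probabilities (summed). -/
lemma crude_sum (S : Setup P f r ρ σ2 K) : ∃ C, 1 ≤ C ∧ ∀ (n : ℕ) x y, -K ≤ y →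
    ∑ k ∈ Finset.range n, (Tl P f ^ k) 1 x y ≤ C * (1 + max y 0) * √n := by
  obtain ⟨h0, hh0, hstep⟩ := WW_step S
  have hK := S.hK
  have hσ := S.hσ
  refine ⟨(4 / σ2 + 1) * (7 * K) + h0, ?_, ?_⟩
  · have : 0 ≤ (4 / σ2 + 1) * (7 * K) := by positivity
    linarith
  intro n x y hy
  have hm0 := le_max_right y 0
  have hC0 : 0 ≤ (4 / σ2 + 1) * (7 * K) := by positivity
  by_cases hn : h0 ≤ √n
  · set h := √(n : ℝ) with hh
    have hpos : 0 < h := by linarith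
    have hsq : h ^ 2 = n := Real.sq_sqrt (Nat.cast_nonneg n)
    have it : ∀ k : ℕ, ∀ x y, -K ≤ y → (Tl P f ^ k) (WW r ρ K h) x y
        + σ2 / 4 * ∑ j ∈ Finset.range k, (Tl P f ^ j) (eW r K h) x y ≤ WW r ρ K h x y := by
      intro k
      induction k with
      | zero => intro x y _; simp
      | succ k ih =>
        intro x y hy
        have a := Tn_mono S (H1 := Tl P f (WW r ρ K h) + (σ2 / 4) • eW r K h)
          (H2 := WW r ρ K h) (fun x y hy => hstep h hn x y hy) k x y hy
        rw [map_add, map_smul, ← Module.End.mul_apply, ← pow_succ] at a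
        simp only [Pi.add_apply, Pi.smul_apply, smul_eq_mul] at a
        rw [Finset.sum_range_succ]
        linarith [ih x y hy]
    have hWnn : ∀ x y, -K ≤ y → 0 ≤ WW r ρ K h x y := by
      intro x y hy
      obtain ⟨a, b⟩ := WW_lower S hpos x y (by linarith)
      refine le_trans ?_ a
      have : 0 ≤ 1 - eW r K h x y := by linarith
      positivity
    have hTW : ∀ k, (Tl P f ^ k) (WW r ρ K h) x y ≤ WW r ρ K h x y := by
      intro k
      have := it k x y hy
      have h2 : 0 ≤ ∑ j ∈ Finset.range k, (Tl P f ^ j) (eW r K h) x y :=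
        Finset.sum_nonneg fun j _ => Tn_nonneg S (fun _ _ _ => (Real.exp_pos _).le) j x y hy
      nlinarith
    have hE : ∑ j ∈ Finset.range n, (Tl P f ^ j) (eW r K h) x y ≤ 4 / σ2 * WW r ρ K h x y := by
      have := it n x y hy
      have h2 := Tn_nonneg S hWnn n x y hy
      have h3 : σ2 / 4 * ∑ j ∈ Finset.range n, (Tl P f ^ j) (eW r K h) x y ≤ WW r ρ K h x y := by
        linarith
      calc _ = 4 / σ2 * (σ2 / 4 * ∑ j ∈ Finset.range n, (Tl P f ^ j) (eW r K h) x y) := by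
            field_simp
        _ ≤ _ := by gcongr
    have hone : ∀ k, (Tl P f ^ k) 1 x y ≤ (Tl P f ^ k) (eW r K h) x y
        + (1 / h ^ 2) * WW r ρ K h x y := by
      intro k
      have a := Tn_mono S (H1 := 1) (H2 := eW r K h + (1 / h ^ 2) • WW r ρ K h) (fun x y hy => by
        have b := (WW_lower S hpos x y (by linarith)).1
        simp only [Pi.one_apply, Pi.add_apply, Pi.smul_apply, smul_eq_mul]
        have : 1 - eW r K h x y ≤ 1 / h ^ 2 * WW r ρ K h x y := by
          rw [div_mul_eq_mul_div, one_mul, le_div_iff₀ (by positivity)]; linarith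
        linarith) k x y hy
      rw [map_add, map_smul] at a
      simp only [Pi.add_apply, Pi.smul_apply, smul_eq_mul] at a
      have := hTW k
      have h3 : 1 / h ^ 2 * (Tl P f ^ k) (WW r ρ K h) x y ≤ 1 / h ^ 2 * WW r ρ K h x y := by
        gcongr
      linarith
    have hW := WW_upper S (by linarith : 1 ≤ h) x y (by linarith)
    calc ∑ k ∈ Finset.range n, (Tl P f ^ k) 1 x y
        ≤ ∑ k ∈ Finset.range n, ((Tl P f ^ k) (eW r K h) x y + (1 / h ^ 2) * WW r ρ K h x y) :=
          Finset.sum_le_sum fun k _ => hone k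
      _ = ∑ k ∈ Finset.range n, (Tl P f ^ k) (eW r K h) x y + WW r ρ K h x y := by
          rw [Finset.sum_add_distrib, Finset.sum_const, Finset.card_range, nsmul_eq_mul, ← hsq]
          field_simp
      _ ≤ (4 / σ2 + 1) * WW r ρ K h x y := by linarith
      _ ≤ (4 / σ2 + 1) * (7 * K * h * (1 + max y 0)) := by gcongr
      _ = ((4 / σ2 + 1) * (7 * K)) * (1 + max y 0) * h := by ring
      _ ≤ _ := by gcongr; linarith
  · push Not at hn
    calc ∑ k ∈ Finset.range n, (Tl P f ^ k) 1 x y ≤ ∑ k ∈ Finset.range n, (1 : ℝ) :=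
          Finset.sum_le_sum fun k _ => Tn_one_le_one S k x y hy
      _ = √n * √n := by simp
      _ ≤ ((4 / σ2 + 1) * (7 * K) + h0) * (1 + max y 0) * √n := by
          gcongr
          nlinarith

lemma crude (S : Setup P f r ρ σ2 K) : ∃ C, 1 ≤ C ∧ (∀ (n : ℕ) x y, -K ≤ y →
    ∑ k ∈ Finset.range n, (Tl P f ^ k) 1 x y ≤ C * (1 + max y 0) * √n) ∧
    (∀ (n : ℕ) x y, 1 ≤ n → -K ≤ y → (Tl P f ^ n) 1 x y ≤ C * (1 + max y 0) / √n) := by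
  obtain ⟨C, hC, h⟩ := crude_sum S
  refine ⟨C, hC, h, ?_⟩
  intro n x y hn hy
  have hs : (n : ℝ) * (Tl P f ^ n) 1 x y ≤ C * (1 + max y 0) * √n := by
    refine le_trans ?_ (h n x y hy)
    calc (n : ℝ) * (Tl P f ^ n) 1 x y = ∑ k ∈ Finset.range n, (Tl P f ^ n) 1 x y := by simp
      _ ≤ _ := Finset.sum_le_sum fun k hk =>
        Tn_one_anti S (Finset.mem_range.1 hk).le x y hy
  have hn0 : 0 < √(n : ℝ) := Real.sqrt_pos.2 (by exact_mod_cast hn)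
  rw [le_div_iff₀ hn0]
  have e : √(n : ℝ) * √n = n := Real.mul_self_sqrt (Nat.cast_nonneg n)
  have : √(n : ℝ) * ((Tl P f ^ n) 1 x y * √n) ≤ √n * (C * (1 + max y 0)) := by
    calc √(n : ℝ) * ((Tl P f ^ n) 1 x y * √n) = (√n * √n) * (Tl P f ^ n) 1 x y := by ring
      _ = n * (Tl P f ^ n) 1 x y := by rw [e]
      _ ≤ _ := hs
      _ = _ := by ring
  exact le_of_mul_le_mul_left this hn0
end




/-- Approximate solution of the heat equation in discrete time, through Taylor inequalities. -/
structure USeq (σ2 C0 A1 A2 A3 : ℝ) (u u1 u2 : ℕ → ℝ → ℝ) : Prop where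
  A1n : 0 ≤ A1
  A2n : 0 ≤ A2
  A3n : 0 ≤ A3
  C0n : 0 ≤ C0
  T3 : ∀ s z d, |u s (z + d) - u s z - u1 s z * d - u2 s z * d ^ 2 / 2| ≤ A3 * |d| ^ 3
  T2 : ∀ s z d, |u2 s (z + d) - u2 s z| ≤ A3 * |d|
  B2 : ∀ s z, |u2 s z| ≤ A2
  T1 : ∀ s z, |u s z - u1 s 0 * z| ≤ A2 * z ^ 2
  L1 : ∀ z d, |u 0 (z + d) - u 0 z| ≤ A1 * |d|
  s0 : ∀ s z, |u (s + 1) z - u s z - σ2 / 2 * u2 s z| ≤ C0 * A3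
  s1 : ∀ s, |u1 (s + 1) 0 - u1 s 0| ≤ C0 * A3
  s2 : ∀ s z, |u2 (s + 1) z - u2 s z| ≤ C0 * A3

/-- The martingale coordinate. -/
def zet (r : X → ℝ) : X → ℝ → ℝ := fun x y => y + r x

/-- Corrected test function. -/
noncomputable def UU (r ρ : X → ℝ) (u u2 : ℕ → ℝ → ℝ) (s : ℕ) : X → ℝ → ℝ :=
  fun x y => u s (y + r x) + ρ x / 2 * u2 s (y + r x)

lemma telescope {E : Type*} [AddCommGroup E] [Module ℝ E] (T : Module.End ℝ E) (a : ℕ → E)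
    (n : ℕ) : a 0 - (T ^ n) (a n) = ∑ k ∈ Finset.range n, (T ^ k) (a k - T (a (k + 1))) := by
  induction n with
  | zero => simp
  | succ n ih =>
    rw [Finset.sum_range_succ, ← ih, map_sub, ← Module.End.mul_apply, ← pow_succ]
    abel

section
variable [Fintype X] {P : X → X → ℝ} {f r ρ : X → ℝ} {σ2 K : ℝ}

lemma Fop_zet (S : Setup P f r ρ σ2 K) : Fop P f (zet r) = zet r := by
  funext x y
  simp only [Fop, zet, add_assoc, mul_add _ y, Finset.sum_add_distrib,
    ← Finset.sum_mul, S.rowSum, S.hr, one_mul]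

lemma Fop_one (S : Setup P f r ρ σ2 K) : Fop P f 1 = 1 := by
  funext x y
  simp [Fop, S.rowSum]

lemma Bop_one (S : Setup P f r ρ σ2 K) : Bop P f 1 = 1 - Tl P f 1 := by
  rw [eq_sub_iff_add_eq, add_comm, ← Fop_eq, Fop_one S]

lemma Bop_zet (S : Setup P f r ρ σ2 K) : Bop P f (zet r) = zet r - Tl P f (zet r) := by
  rw [eq_sub_iff_add_eq, add_comm, ← Fop_eq, Fop_zet S]

lemma Bop_sub_abs (S : Setup P f r ρ σ2 K) (H1 H2 : X → ℝ → ℝ) (M c : ℝ) (y : ℝ)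
    (hy : -K ≤ y)
    (h : ∀ x' y', -(2 * K) ≤ y' → y' ≤ 0 → |H1 x' y' - c * H2 x' y'| ≤ M) (x : X) :
    |Bop P f H1 x y - c * Bop P f H2 x y| ≤ M * Bop P f 1 x y := by
  unfold Bop
  rw [Finset.mul_sum, Finset.mul_sum, ← Finset.sum_sub_distrib]
  refine (Finset.abs_sum_le_sum_abs _ _).trans (Finset.sum_le_sum fun x' _ => ?_)
  have hp := S.nonneg x x'
  split_ifs with h'
  · simp
  · have hh := h x' (y + f x') (by linarith [(abs_le.1 (S.fK x')).1]) (not_lt.1 h')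
    rw [mul_left_comm c, ← mul_sub, abs_mul, abs_of_nonneg hp]
    simp only [Pi.one_apply, mul_one]
    rw [mul_comm M]
    exact mul_le_mul_of_nonneg_left hh hp

lemma zet_exit (S : Setup P f r ρ σ2 K) (x : X) (y : ℝ) (h1 : -(2 * K) ≤ y) (h2 : y ≤ 0) :
    |y + r x| ≤ 3 * K := by
  have a := abs_le.1 (S.rK x)
  rw [abs_le]; constructor <;> linarith [S.hK]

lemma zet_dom (S : Setup P f r ρ σ2 K) (x : X) (y : ℝ) (h1 : -K ≤ y) :
    |y + r x| ≤ max y 0 + 2 * K := by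
  have a := abs_le.1 (S.rK x)
  rw [abs_le]; constructor <;> linarith [S.hK, le_max_left y 0, le_max_right y 0]

lemma D_step (S : Setup P f r ρ σ2 K) (k : ℕ) (x : X) (y : ℝ) (hy : -K ≤ y) :
    |(Tl P f ^ k) (zet r) x y - (Tl P f ^ (k + 1)) (zet r) x y|
      ≤ 3 * K * ((Tl P f ^ k) 1 x y - (Tl P f ^ (k + 1)) 1 x y) := by
  have a := Tn_abs S (H1 := Bop P f (zet r)) (H2 := (3 * K) • Bop P f 1) (fun x y hy => by
    have := Bop_sub_abs S (zet r) 0 (3 * K) 0 y hy (fun x' y' h1 h2 => by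
      simpa [zet] using zet_exit S x' y' h1 h2) x
    simpa using this) k x y hy
  rw [map_smul, Bop_one S, Bop_zet S, map_sub, map_sub, ← Module.End.mul_apply,
    ← Module.End.mul_apply, ← pow_succ] at a
  exact a

lemma D_diff (S : Setup P f r ρ σ2 K) {m n : ℕ} (hmn : m ≤ n) (x : X) (y : ℝ) (hy : -K ≤ y) :
    |(Tl P f ^ m) (zet r) x y - (Tl P f ^ n) (zet r) x y|
      ≤ 3 * K * ((Tl P f ^ m) 1 x y - (Tl P f ^ n) 1 x y) := by
  induction n, hmn using Nat.le_induction with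
  | base => simp
  | succ n _ ih =>
    have := D_step S n x y hy
    have t := abs_sub_le ((Tl P f ^ m) (zet r) x y) ((Tl P f ^ n) (zet r) x y)
      ((Tl P f ^ (n + 1)) (zet r) x y)
    linarith

lemma D_bound (S : Setup P f r ρ σ2 K) (n : ℕ) (x : X) (y : ℝ) (hy : -K ≤ y) :
    |(Tl P f ^ n) (zet r) x y| ≤ 5 * K * (1 + max y 0) := by
  have a := D_diff S (Nat.zero_le n) x y hy
  have b := zet_dom S x y hy
  have c := Tn_one_nonneg S n x y hy
  simp only [pow_zero, Module.End.one_apply, Pi.one_apply] at a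
  have hz : zet r x y = y + r x := rfl
  rw [hz] at a
  have t := abs_sub_abs_le_abs_sub ((Tl P f ^ n) (zet r) x y) (y + r x)
  rw [abs_sub_comm] at t
  have hK := S.hK
  have := le_max_right y 0
  nlinarith

lemma U_step (S : Setup P f r ρ σ2 K) {C0 A1 A2 A3 : ℝ} {u u1 u2 : ℕ → ℝ → ℝ}
    (hu : USeq σ2 C0 A1 A2 A3 u u1 u2) (s : ℕ) (x : X) (y : ℝ) :
    |UU r ρ u u2 (s + 1) x y - Fop P f (UU r ρ u u2 s) x y| ≤ (54 * K ^ 4 + 2 * K * C0) * A3 := by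
  have hK := S.hK
  have hA3 := hu.A3n
  have hK3 : 3 * K ≤ 27 * K ^ 3 := by
    nlinarith [mul_self_nonneg (K - 1), mul_pos (by linarith : 0 < K) (by linarith : 0 < K)]
  have g := generator S (u s) (u2 s) (u1 s (y + r x)) (y + r x) (27 * K ^ 3 * A3) x ?_ ?_
  · have hF : Fop P f (UU r ρ u u2 s) x y = ∑ x', P x x' *
        (u s (y + r x + (f x' + r x' - r x)) + ρ x' / 2 * u2 s (y + r x + (f x' + r x' - r x))) := by
      unfold Fop UU
      refine Finset.sum_congr rfl fun x' _ => ?_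
      have e2 : y + r x + (f x' + r x' - r x) = y + f x' + r x' := by ring
      rw [e2]
    rw [← hF] at g
    have a := hu.s0 s (y + r x)
    have b := hu.s2 s (y + r x)
    have c : |ρ x / 2 * (u2 (s + 1) (y + r x) - u2 s (y + r x))| ≤ K * (C0 * A3) := by
      rw [abs_mul]
      refine mul_le_mul ?_ b (abs_nonneg _) (by linarith)
      rw [abs_div, abs_two]; linarith [S.ρK x]
    have hCA : 0 ≤ C0 * A3 := mul_nonneg hu.C0n hA3
    have hKCA : C0 * A3 ≤ K * (C0 * A3) := by nlinarith
    have eU : ∀ s, UU r ρ u u2 s x y = u s (y + r x) + ρ x / 2 * u2 s (y + r x) := fun _ => rfl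
    rw [eU, abs_le]
    rw [abs_le] at g a c
    constructor <;> nlinarith
  · intro d hd
    refine (hu.T3 s _ d).trans ?_
    have : |d| ^ 3 ≤ (3 * K) ^ 3 := pow_le_pow_left₀ (abs_nonneg _) hd 3
    nlinarith
  · intro d hd
    refine (hu.T2 s _ d).trans ?_
    nlinarith

lemma sum_weighted (a : ℕ → ℝ) (n : ℕ) :
    ∑ k ∈ Finset.range n, ((k : ℝ) + 1) * (a k - a (k + 1))
      = ∑ k ∈ Finset.range n, a k - n * a n := by
  induction n with
  | zero => simp
  | succ n ih => rw [Finset.sum_range_succ, ih, Finset.sum_range_succ]; push_cast; ring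

lemma u1_diff {C0 A1 A2 A3 : ℝ} {u u1 u2 : ℕ → ℝ → ℝ}
    (hu : USeq σ2 C0 A1 A2 A3 u u1 u2) (s j : ℕ) :
    |u1 (s + j) 0 - u1 s 0| ≤ j * (C0 * A3) := by
  induction j with
  | zero => simp
  | succ j ih =>
    have a := hu.s1 (s + j)
    have t := abs_sub_le (u1 (s + j + 1) 0) (u1 (s + j) 0) (u1 s 0)
    rw [← add_assoc]
    push_cast
    linarith

lemma expansion (S : Setup P f r ρ σ2 K) {C0 A1 A2 A3 : ℝ} {u u1 u2 : ℕ → ℝ → ℝ}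
    (hu : USeq σ2 C0 A1 A2 A3 u u1 u2) (n : ℕ) (x : X) (y : ℝ) (hy : -K ≤ y) :
    |(Tl P f ^ n) (fun _ y => u 0 y) x y - u1 n 0 * (Tl P f ^ n) (zet r) x y| ≤
      (54 * K ^ 4 + 5 * K * C0) * A3 * ∑ k ∈ Finset.range n, (Tl P f ^ k) 1 x y
      + A2 * (20 * K ^ 2 + (max y 0 + 2 * K) ^ 2) + A1 * K * (Tl P f ^ n) 1 x y := by
  have hK := S.hK
  have hA3 := hu.A3n
  have hA2 := hu.A2n
  have hA1 := hu.A1n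
  have hC0 := hu.C0n
  set c := u1 n 0 with hc
  set T := Tl P f with hT
  set U := UU r ρ u u2 with hU
  have hρ2 : ∀ x s z, |ρ x / 2 * u2 s z| ≤ K * A2 := by
    intro x s z
    rw [abs_mul]
    refine mul_le_mul ?_ (hu.B2 s z) (abs_nonneg _) (by linarith)
    rw [abs_div, abs_two]; linarith [S.ρK x]
  have t1 := telescope T (fun k => U (n - k)) n
  have t2 := telescope T (fun _ => zet r) n
  simp only [Nat.sub_self, Nat.sub_zero] at t1
  have t3 : U n x y - (T ^ n) (U 0) x y - c * (zet r x y - (T ^ n) (zet r) x y)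
      = ∑ k ∈ Finset.range n, ((T ^ k) (U (n - k) - T (U (n - (k + 1))) - c • (zet r - T (zet r))))
        x y := by
    have e1 := congrFun (congrFun t1 x) y
    have e2 := congrFun (congrFun t2 x) y
    simp only [Pi.sub_apply] at e1 e2
    rw [e1, e2]
    simp only [Finset.sum_apply, Finset.mul_sum, ← Finset.sum_sub_distrib, map_sub, map_smul,
      Pi.sub_apply, Pi.smul_apply, smul_eq_mul]
  have term : ∀ k ∈ Finset.range n,
      |((T ^ k) (U (n - k) - T (U (n - (k + 1))) - c • (zet r - T (zet r)))) x y|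
      ≤ (54 * K ^ 4 + 2 * K * C0) * A3 * (T ^ k) 1 x y
        + (10 * K ^ 2 * A2 + 3 * K * (C0 * A3) * ((k : ℝ) + 1))
          * ((T ^ k) 1 x y - (T ^ (k + 1)) 1 x y) := by
    intro k hk
    have hkn := Finset.mem_range.1 hk
    obtain ⟨s, hs⟩ : ∃ s, n = s + (k + 1) := ⟨n - (k + 1), by omega⟩
    have es1 : n - (k + 1) = s := by omega
    have es2 : n - k = s + 1 := by omega
    have key := Tn_abs S (H1 := U (n - k) - T (U (n - (k + 1))) - c • (zet r - T (zet r)))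
      (H2 := ((54 * K ^ 4 + 2 * K * C0) * A3) • (1 : X → ℝ → ℝ)
        + (10 * K ^ 2 * A2 + 3 * K * (C0 * A3) * ((k : ℝ) + 1)) • Bop P f 1)
      (fun x y hy => ?_) k x y hy
    · have e1 : (Tl P f ^ k) (1 - Tl P f 1) = (Tl P f ^ k) 1 - (Tl P f ^ (k + 1)) 1 := by
        rw [map_sub, ← Module.End.mul_apply, ← pow_succ]
      rw [map_add, map_smul, map_smul, Bop_one S, e1] at key
      exact key
    · rw [es1, es2, hT, ← Bop_zet S]
      have a := U_step S hu s x y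
      have hdec : Fop P f (U s) x y = Tl P f (U s) x y + Bop P f (U s) x y := by
        rw [Fop_eq]; rfl
      have b := Bop_sub_abs S (U s) (zet r)
        (10 * K ^ 2 * A2 + 3 * K * (C0 * A3) * ((k : ℝ) + 1)) c y hy (fun x' y' h1 h2 => ?_) x
      · simp only [Pi.sub_apply, Pi.add_apply, Pi.smul_apply, smul_eq_mul, Pi.one_apply, mul_one]
        rw [← hU] at a
        have e : U (s + 1) x y - Tl P f (U s) x y - c * Bop P f (zet r) x y
            = (U (s + 1) x y - Fop P f (U s) x y)
              + (Bop P f (U s) x y - c * Bop P f (zet r) x y) := by rw [hdec]; ring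
        rw [e]
        exact (abs_add_le _ _).trans (add_le_add a b)
      · have z := zet_exit S x' y' h1 h2
        have d1 := hu.T1 s (y' + r x')
        have d2 := hρ2 x' s (y' + r x')
        have d3 := u1_diff hu s (k + 1)
        rw [← hs, ← hc, abs_sub_comm] at d3
        push_cast at d3
        have z2 : (y' + r x') ^ 2 ≤ 9 * K ^ 2 := by
          rw [← sq_abs]; nlinarith [abs_nonneg (y' + r x')]
        have d4 : |(u1 s 0 - c) * (y' + r x')| ≤ ((k : ℝ) + 1) * (C0 * A3) * (3 * K) := by
          rw [abs_mul]
          exact mul_le_mul d3 z (abs_nonneg _) (by positivity)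
        have e : U s x' y' - c * zet r x' y' = (u s (y' + r x') - u1 s 0 * (y' + r x'))
            + (u1 s 0 - c) * (y' + r x') + ρ x' / 2 * u2 s (y' + r x') := by
          simp only [hU, UU, zet]; ring
        rw [e]
        have q1 : A2 * (y' + r x') ^ 2 ≤ A2 * (9 * K ^ 2) := by gcongr
        have q2 : K * A2 ≤ K ^ 2 * A2 := by
          have : K ≤ K ^ 2 := by nlinarith
          gcongr
        refine (abs_add_three _ _ _).trans ?_
        linarith
  have sumb : |U n x y - (T ^ n) (U 0) x y - c * (zet r x y - (T ^ n) (zet r) x y)|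
      ≤ (54 * K ^ 4 + 5 * K * C0) * A3 * ∑ k ∈ Finset.range n, (T ^ k) 1 x y
        + 10 * K ^ 2 * A2 := by
    rw [t3]
    refine (Finset.abs_sum_le_sum_abs _ _).trans ((Finset.sum_le_sum term).trans ?_)
    have w := sum_weighted (fun k => (T ^ k) 1 x y) n
    have w2 := Finset.sum_range_sub' (fun k => (T ^ k) 1 x y) n
    simp only [add_mul, Finset.sum_add_distrib, mul_assoc, ← Finset.mul_sum] at w w2 ⊢
    rw [w2] at w ⊢
    rw [w]
    have n0 := Tn_one_nonneg S n x y hy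
    rw [← hT] at n0
    have p1 : 0 ≤ K * (C0 * A3) * (n * (T ^ n) 1 x y) := by positivity
    have p2 : 0 ≤ K ^ 2 * A2 * (T ^ n) 1 x y := by positivity
    simp only [pow_zero, Module.End.one_apply, Pi.one_apply]
    nlinarith
  have fin1 : |U n x y - c * zet r x y| ≤ A2 * (max y 0 + 2 * K) ^ 2 + K * A2 := by
    have e : U n x y - c * zet r x y = (u n (y + r x) - u1 n 0 * (y + r x))
        + ρ x / 2 * u2 n (y + r x) := by simp only [hU, UU, zet, hc]; ring
    rw [e]
    refine (abs_add_le _ _).trans (add_le_add ((hu.T1 n _).trans ?_) (hρ2 _ _ _))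
    have := zet_dom S x y hy
    gcongr 1
    rw [← sq_abs]
    gcongr
  have fin2 : |(T ^ n) (fun _ y => u 0 y) x y - (T ^ n) (U 0) x y|
      ≤ (A1 * K + K * A2) * (T ^ n) 1 x y := by
    have key := Tn_abs S (H1 := (fun _ y => u 0 y) - U 0)
      (H2 := (A1 * K + K * A2) • (1 : X → ℝ → ℝ)) (fun x y hy => ?_) n x y hy
    · rw [map_sub, map_smul] at key
      exact key
    · simp only [hU, UU, Pi.sub_apply, Pi.smul_apply, Pi.one_apply, smul_eq_mul, mul_one]
      have a := hu.L1 y (r x)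
      have b := hρ2 x 0 (y + r x)
      have e : u 0 y - (u 0 (y + r x) + ρ x / 2 * u2 0 (y + r x))
        = -((u 0 (y + r x) - u 0 y) + ρ x / 2 * u2 0 (y + r x)) := by ring
      rw [e, abs_neg]
      refine (abs_add_le _ _).trans (add_le_add (a.trans ?_) b)
      exact mul_le_mul_of_nonneg_left (S.rK x) hA1
  have n1 := Tn_one_le_one S n x y hy
  have n0 := Tn_one_nonneg S n x y hy
  rw [← hT] at n1 n0
  have q2 : K * A2 ≤ K ^ 2 * A2 := by
    have : K ≤ K ^ 2 := by nlinarith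
    gcongr
  have q3 : K * A2 * (T ^ n) 1 x y ≤ K * A2 := by
    have : 0 ≤ K * A2 := by positivity
    nlinarith
  have q4 : 0 ≤ K ^ 2 * A2 := by positivity
  rw [abs_le] at sumb fin1 fin2 ⊢
  constructor <;> nlinarith

lemma expansion' (S : Setup P f r ρ σ2 K) (C0 : ℝ) (hC0 : 0 ≤ C0) : ∃ C, 1 ≤ C ∧
    ∀ (A1 A2 A3 : ℝ) (u u1 u2 : ℕ → ℝ → ℝ), USeq σ2 C0 A1 A2 A3 u u1 u2 →
    ∀ (n : ℕ) (x : X) (y : ℝ), 1 ≤ n → -K ≤ y →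
    |(Tl P f ^ n) (fun _ y => u 0 y) x y - u1 n 0 * (Tl P f ^ n) (zet r) x y| ≤
      C * (1 + max y 0 ^ 2) * (A3 * √n + A2 + A1 / √n) := by
  obtain ⟨C, hC, c1, c2⟩ := crude S
  have hK := S.hK
  refine ⟨(54 * K ^ 4 + 5 * K * C0) * (2 * C) + 28 * K ^ 2 + 2 * C * K, ?_, ?_⟩
  · have : 0 ≤ (54 * K ^ 4 + 5 * K * C0) * (2 * C) := by positivity
    have : 0 ≤ 2 * C * K := by positivity
    nlinarith
  intro A1 A2 A3 u u1 u2 hu n x y hn hy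
  have e := expansion S hu n x y hy
  have a := c1 n x y hy
  have b := c2 n x y hn hy
  have hA3 := hu.A3n
  have hA2 := hu.A2n
  have hA1 := hu.A1n
  set m := max y 0 with hm
  have hm0 : 0 ≤ m := le_max_right _ _
  have hn0 : 0 < √(n : ℝ) := Real.sqrt_pos.2 (by exact_mod_cast hn)
  have hmm : 1 + m ≤ 2 * (1 + m ^ 2) := by nlinarith
  have e1 : (54 * K ^ 4 + 5 * K * C0) * A3 * ∑ k ∈ Finset.range n, (Tl P f ^ k) 1 x y
      ≤ (54 * K ^ 4 + 5 * K * C0) * (2 * C) * (1 + m ^ 2) * (A3 * √n) := by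
    calc _ ≤ (54 * K ^ 4 + 5 * K * C0) * A3 * (C * (1 + m) * √n) := by gcongr
      _ ≤ (54 * K ^ 4 + 5 * K * C0) * A3 * (C * (2 * (1 + m ^ 2)) * √n) := by gcongr
      _ = _ := by ring
  have e2 : A2 * (20 * K ^ 2 + (m + 2 * K) ^ 2) ≤ 28 * K ^ 2 * (1 + m ^ 2) * A2 := by
    have : (20 * K ^ 2 + (m + 2 * K) ^ 2) ≤ 28 * K ^ 2 * (1 + m ^ 2) := by
      nlinarith [sq_nonneg (m - 2 * K), sq_nonneg m, mul_nonneg (sq_nonneg m) (by nlinarith : 0 ≤ K ^ 2 - 1)]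
    nlinarith
  have e3 : A1 * K * (Tl P f ^ n) 1 x y ≤ 2 * C * K * (1 + m ^ 2) * (A1 / √n) := by
    calc _ ≤ A1 * K * (C * (1 + m) / √n) := by gcongr
      _ ≤ A1 * K * (C * (2 * (1 + m ^ 2)) / √n) := by gcongr
      _ = _ := by ring
  have p1 : 0 ≤ (1 + m ^ 2) * (A3 * √n) := by positivity
  have p2 : 0 ≤ (1 + m ^ 2) * A2 := by positivity
  have p3 : 0 ≤ (1 + m ^ 2) * (A1 / √n) := by positivity
  set k1 := (54 * K ^ 4 + 5 * K * C0) * (2 * C) with hk1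
  set k2 := 28 * K ^ 2 with hk2
  set k3 := 2 * C * K with hk3
  have q1 : 0 ≤ k1 := by positivity
  have q2 : 0 ≤ k2 := by positivity
  have q3 : 0 ≤ k3 := by positivity
  have fe : (k1 + k2 + k3) * (1 + m ^ 2) * (A3 * √n + A2 + A1 / √n)
    = k1 * (1 + m ^ 2) * (A3 * √n) + k2 * (1 + m ^ 2) * A2 + k3 * (1 + m ^ 2) * (A1 / √n)
     + (k2 + k3) * ((1 + m ^ 2) * (A3 * √n)) + (k1 + k3) * ((1 + m ^ 2) * A2)
     + (k1 + k2) * ((1 + m ^ 2) * (A1 / √n)) := by ring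
  rw [fe]
  have := mul_nonneg (add_nonneg q2 q3) p1
  have := mul_nonneg (add_nonneg q1 q3) p2
  have := mul_nonneg (add_nonneg q1 q2) p3
  linarith
end




/-- Test function with two derivatives, controlled by Taylor inequalities. -/
structure Tri (A1 A2 A3 : ℝ) (g g1 g2 : ℝ → ℝ) : Prop where
  c0 : Continuous g
  c1 : Continuous g1
  c2 : Continuous g2
  b0 : ∀ z, |g z| ≤ 2
  b1 : ∀ z, |g1 z| ≤ A1
  b2 : ∀ z, |g2 z| ≤ A2
  t3 : ∀ z d, |g (z + d) - g z - g1 z * d - g2 z * d ^ 2 / 2| ≤ A3 * |d| ^ 3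
  t21 : ∀ z d, |g1 (z + d) - g1 z - g2 z * d| ≤ A3 * d ^ 2
  t2 : ∀ z d, |g2 (z + d) - g2 z| ≤ A3 * |d|
  t1 : ∀ z d, |g (z + d) - g z - g1 z * d| ≤ A2 * d ^ 2
  l1 : ∀ z d, |g (z + d) - g z| ≤ A1 * |d|

lemma mv (h h' : ℝ → ℝ) (hh : ∀ t, HasDerivAt h (h' t) t) (z d M : ℝ)
    (hM : ∀ t, |t - z| ≤ |d| → |h' t| ≤ M) : |h (z + d) - h z| ≤ M * |d| := by
  have := (convex_closedBall z |d|).norm_image_sub_le_of_norm_hasDerivWithin_le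
    (f := h) (f' := h') (C := M) (x := z) (y := z + d) (fun t _ => (hh t).hasDerivWithinAt)
    (fun t ht => by
      rw [Metric.mem_closedBall, Real.dist_eq] at ht
      exact hM t ht) (by simp) (by simp)
  simpa using this

lemma tri_of_deriv (C : ℝ) (hC : 0 ≤ C) (g g1 g2 g3 : ℝ → ℝ)
    (h0 : ∀ t, HasDerivAt g (g1 t) t) (h1 : ∀ t, HasDerivAt g1 (g2 t) t)
    (h2 : ∀ t, HasDerivAt g2 (g3 t) t) (b0 : ∀ z, |g z| ≤ 2) (b1 : ∀ z, |g1 z| ≤ C)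
    (b2 : ∀ z, |g2 z| ≤ C) (b3 : ∀ z, |g3 z| ≤ C) : Tri C C C g g1 g2 := by
  have l1 : ∀ z d, |g (z + d) - g z| ≤ C * |d| := fun z d => mv _ _ h0 z d C fun t _ => b1 t
  have l2 : ∀ z d, |g1 (z + d) - g1 z| ≤ C * |d| := fun z d => mv _ _ h1 z d C fun t _ => b2 t
  have l3 : ∀ z d, |g2 (z + d) - g2 z| ≤ C * |d| := fun z d => mv _ _ h2 z d C fun t _ => b3 t
  have t1 : ∀ z d, |g (z + d) - g z - g1 z * d| ≤ C * d ^ 2 := by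
    intro z d
    have := mv (fun t => g t - g1 z * (t - z)) (fun t => g1 t - g1 z)
      (fun t => by
        have := (h0 t).sub (((hasDerivAt_id t).sub_const z).const_mul (g1 z))
        exact this.congr_deriv (by simp)) z d (C * |d|) (fun t ht => by
          have := l2 z (t - z)
          rw [add_sub_cancel] at this
          exact this.trans (by gcongr))
    rw [← sq_abs d]
    calc _ = |g (z + d) - g1 z * (z + d - z) - (g z - g1 z * (z - z))| := by congr 1; ring
      _ ≤ _ := this
      _ = _ := by ring
  have t21 : ∀ z d, |g1 (z + d) - g1 z - g2 z * d| ≤ C * d ^ 2 := by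
    intro z d
    have := mv (fun t => g1 t - g2 z * (t - z)) (fun t => g2 t - g2 z)
      (fun t => by
        have := (h1 t).sub (((hasDerivAt_id t).sub_const z).const_mul (g2 z))
        exact this.congr_deriv (by simp)) z d (C * |d|) (fun t ht => by
          have := l3 z (t - z)
          rw [add_sub_cancel] at this
          exact this.trans (by gcongr))
    rw [← sq_abs d]
    calc _ = |g1 (z + d) - g2 z * (z + d - z) - (g1 z - g2 z * (z - z))| := by congr 1; ring
      _ ≤ _ := this
      _ = _ := by ring
  refine ⟨?_, ?_, ?_, b0, b1, b2, ?_, t21, l3, t1, l1⟩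
  · exact continuous_iff_continuousAt.2 fun t => (h0 t).continuousAt
  · exact continuous_iff_continuousAt.2 fun t => (h1 t).continuousAt
  · exact continuous_iff_continuousAt.2 fun t => (h2 t).continuousAt
  · intro z d
    have := mv (fun t => g t - g1 z * (t - z) - g2 z * (t - z) ^ 2 / 2)
      (fun t => g1 t - g1 z - g2 z * (t - z))
      (fun t => by
        have a := (h0 t).sub (((hasDerivAt_id t).sub_const z).const_mul (g1 z))
        have b := ((((hasDerivAt_id t).sub_const z).pow 2).const_mul (g2 z)).div_const 2
        have c := a.sub b
        refine c.congr_deriv ?_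
        simp; ring) z d (C * |d| ^ 2) (fun t ht => by
          have := t21 z (t - z)
          rw [add_sub_cancel] at this
          refine this.trans ?_
          rw [← sq_abs (t - z)]
          gcongr)
    calc _ = |g (z + d) - g1 z * (z + d - z) - g2 z * (z + d - z) ^ 2 / 2
          - (g z - g1 z * (z - z) - g2 z * (z - z) ^ 2 / 2)| := by congr 1; ring
      _ ≤ _ := this
      _ = _ := by ring

/-- smooth step and its derivatives -/
noncomputable def th (t : ℝ) : ℝ := Real.smoothTransition t
noncomputable def th1 : ℝ → ℝ := deriv th
noncomputable def th2 : ℝ → ℝ := deriv th1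
noncomputable def th3 : ℝ → ℝ := deriv th2

lemma th_cd : ContDiff ℝ 5 th := Real.smoothTransition.contDiff (n := 5)
lemma th1_cd : ContDiff ℝ 4 th1 := by
  have := (contDiff_succ_iff_deriv (n := 4) (f := th) (𝕜 := ℝ)).1 (by exact_mod_cast th_cd)
  exact this.2.2
lemma th2_cd : ContDiff ℝ 3 th2 := by
  have := (contDiff_succ_iff_deriv (n := 3) (f := th1) (𝕜 := ℝ)).1 (by exact_mod_cast th1_cd)
  exact this.2.2
lemma th3_cd : ContDiff ℝ 2 th3 := by
  have := (contDiff_succ_iff_deriv (n := 2) (f := th2) (𝕜 := ℝ)).1 (by exact_mod_cast th2_cd)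
  exact this.2.2

lemma th1_zero (t : ℝ) (ht : t < 0 ∨ 1 < t) : th1 t = 0 := by
  unfold th1
  rcases ht with ht | ht
  · have : th =ᶠ[𝓝 t] fun _ => 0 := by
      filter_upwards [Iio_mem_nhds ht] with s hs
      exact Real.smoothTransition.zero_of_nonpos (le_of_lt hs)
    rw [this.deriv_eq]; simp
  · have : th =ᶠ[𝓝 t] fun _ => 1 := by
      filter_upwards [Ioi_mem_nhds ht] with s hs
      exact Real.smoothTransition.one_of_one_le (le_of_lt hs)
    rw [this.deriv_eq]; simp

lemma th1_cs : HasCompactSupport th1 := by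
  refine HasCompactSupport.intro (isCompact_Icc (a := (0:ℝ)) (b := 1)) fun t ht => th1_zero t ?_
  rw [Set.mem_Icc, not_and_or, not_le, not_le] at ht
  exact ht

lemma th1_nonneg (t : ℝ) : 0 ≤ th1 t := Real.smoothTransition.monotone.deriv_nonneg

lemma th_tri : ∃ C, 1 ≤ C ∧ Tri C C C th th1 th2 := by
  obtain ⟨C1, h1⟩ := th1_cd.continuous.bounded_above_of_compact_support th1_cs
  obtain ⟨C2, h2⟩ := th2_cd.continuous.bounded_above_of_compact_support th1_cs.deriv
  obtain ⟨C3, h3⟩ := th3_cd.continuous.bounded_above_of_compact_support th1_cs.deriv.deriv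
  have e1 := (norm_nonneg _).trans (h1 0)
  have e2 := (norm_nonneg _).trans (h2 0)
  have e3 := (norm_nonneg _).trans (h3 0)
  refine ⟨1 + C1 + C2 + C3, by linarith, tri_of_deriv _ (by linarith) _ _ _ th3 ?_ ?_ ?_ ?_ ?_ ?_ ?_⟩
  · exact fun t => ((th_cd.differentiable (by norm_num)) t).hasDerivAt
  · exact fun t => ((th1_cd.differentiable (by norm_num)) t).hasDerivAt
  · exact fun t => ((th2_cd.differentiable (by norm_num)) t).hasDerivAt
  · intro z
    have a := Real.smoothTransition.nonneg z
    have b := Real.smoothTransition.le_one z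
    unfold th
    rw [abs_of_nonneg a]; linarith
  · intro z; have := h1 z; rw [Real.norm_eq_abs] at this; linarith
  · intro z; have := h2 z; rw [Real.norm_eq_abs] at this; linarith
  · intro z; have := h3 z; rw [Real.norm_eq_abs] at this; linarith

/-- The odd test functions -/
noncomputable def gg (b L w : ℝ) : ℝ := th ((w - b) / L) - th ((-w - b) / L)
noncomputable def gg1 (b L w : ℝ) : ℝ := (th1 ((w - b) / L) + th1 ((-w - b) / L)) / L
noncomputable def gg2 (b L w : ℝ) : ℝ := (th2 ((w - b) / L) - th2 ((-w - b) / L)) / L ^ 2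

lemma gg_odd (b L w : ℝ) : gg b L (-w) = - gg b L w := by simp [gg]

lemma gg_zero (b L w : ℝ) (hb : 0 ≤ b) (hL : 0 < L) (hw : 0 ≤ w) (h : w ≤ b) : gg b L w = 0 := by
  unfold gg th
  rw [Real.smoothTransition.zero_of_nonpos, Real.smoothTransition.zero_of_nonpos, sub_zero]
  · exact div_nonpos_of_nonpos_of_nonneg (by linarith) hL.le
  · exact div_nonpos_of_nonpos_of_nonneg (by linarith) hL.le

lemma gg_eq (b L w : ℝ) (hb : 0 ≤ b) (hL : 0 < L) (hw : 0 ≤ w) : gg b L w = th ((w - b) / L) := by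
  unfold gg
  rw [show th ((-w-b)/L) = 0 from Real.smoothTransition.zero_of_nonpos
    (div_nonpos_of_nonpos_of_nonneg (by linarith) hL.le), sub_zero]

lemma gg_one (b L w : ℝ) (hb : 0 ≤ b) (hL : 0 < L) (h : b + L ≤ w) : gg b L w = 1 := by
  rw [gg_eq b L w hb hL (by linarith)]
  exact Real.smoothTransition.one_of_one_le (by rw [le_div_iff₀ hL]; linarith)

lemma gg_nonneg (b L w : ℝ) (hb : 0 ≤ b) (hL : 0 < L) (hw : 0 ≤ w) : 0 ≤ gg b L w := by
  rw [gg_eq b L w hb hL hw]; exact Real.smoothTransition.nonneg _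

lemma gg_le_one (b L w : ℝ) (hb : 0 ≤ b) (hL : 0 < L) (hw : 0 ≤ w) : gg b L w ≤ 1 := by
  rw [gg_eq b L w hb hL hw]; exact Real.smoothTransition.le_one _

lemma gg_tri {C : ℝ} (T : Tri C C C th th1 th2) (b L : ℝ) (hL : 0 < L) :
    Tri (2 * C / L) (2 * C / L ^ 2) (2 * C / L ^ 3) (gg b L) (gg1 b L) (gg2 b L) := by
  have key : ∀ z d : ℝ, (z + d - b) / L = (z - b) / L + d / L := fun z d => by ring
  have key' : ∀ z d : ℝ, (-(z + d) - b) / L = (-z - b) / L + (-(d / L)) := fun z d => by ring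
  have hL0 : L ≠ 0 := hL.ne'
  have c0 := T.c0
  have c1 := T.c1
  have c2 := T.c2
  have cA : ∀ s e, |s| ≤ e → |s / L| ≤ e / L := fun s e h => by
    rw [abs_div, abs_of_pos hL]; gcongr
  have cB : ∀ s e, |s| ≤ e → |s / L ^ 2| ≤ e / L ^ 2 := fun s e h => by
    rw [abs_div, abs_of_pos (pow_pos hL 2)]; gcongr
  have two : ∀ a b e : ℝ, |a| ≤ e → |b| ≤ e → |a - b| ≤ 2 * e := fun a b e h1 h2 => by
    have := abs_sub a b; linarith
  have two' : ∀ a b e : ℝ, |a| ≤ e → |b| ≤ e → |a + b| ≤ 2 * e := fun a b e h1 h2 => by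
    have := abs_add_le a b; linarith
  have ad : ∀ d : ℝ, |d / L| = |d| / L := fun d => by rw [abs_div, abs_of_pos hL]
  refine ⟨?_, ?_, ?_, ?_, ?_, ?_, ?_, ?_, ?_, ?_, ?_⟩
  · unfold gg; fun_prop
  · unfold gg1; fun_prop
  · unfold gg2; fun_prop
  · intro z
    have a := Real.smoothTransition.nonneg ((z - b) / L)
    have b' := Real.smoothTransition.le_one ((z - b) / L)
    have a2 := Real.smoothTransition.nonneg ((-z - b) / L)
    have b2 := Real.smoothTransition.le_one ((-z - b) / L)
    unfold gg th
    rw [abs_le]; constructor <;> linarith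
  · intro z; exact cA _ _ (two' _ _ _ (T.b1 _) (T.b1 _))
  · intro z; exact cB _ _ (two _ _ _ (T.b2 _) (T.b2 _))
  · intro z d
    have := two _ _ _ (T.t3 ((z - b) / L) (d / L)) (by
      have := T.t3 ((-z - b) / L) (-(d / L)); rwa [abs_neg] at this)
    rw [ad] at this
    unfold gg gg1 gg2
    rw [key, key']
    refine le_trans (le_of_eq ?_) (this.trans (le_of_eq ?_))
    · congr 1; field_simp; ring
    · field_simp
  · intro z d
    have := cA _ _ (two' _ _ _ (T.t21 ((z - b) / L) (d / L)) (by
      have := T.t21 ((-z - b) / L) (-(d / L)); rwa [neg_sq] at this))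
    unfold gg1 gg2
    rw [key, key']
    refine le_trans (le_of_eq ?_) (this.trans (le_of_eq ?_))
    · congr 1; field_simp; ring
    · field_simp
  · intro z d
    have := cB _ _ (two _ _ _ (T.t2 ((z - b) / L) (d / L)) (by
      have := T.t2 ((-z - b) / L) (-(d / L)); rwa [abs_neg] at this))
    rw [ad] at this
    unfold gg2
    rw [key, key']
    refine le_trans (le_of_eq ?_) (this.trans (le_of_eq ?_))
    · congr 1; field_simp; ring
    · field_simp
  · intro z d
    have := two _ _ _ (T.t1 ((z - b) / L) (d / L)) (by
      have := T.t1 ((-z - b) / L) (-(d / L)); rwa [neg_sq] at this)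
    unfold gg gg1
    rw [key, key']
    refine le_trans (le_of_eq ?_) (this.trans (le_of_eq ?_))
    · congr 1; field_simp; ring
    · field_simp
  · intro z d
    have := two _ _ _ (T.l1 ((z - b) / L) (d / L)) (by
      have := T.l1 ((-z - b) / L) (-(d / L)); rwa [abs_neg] at this)
    rw [ad] at this
    unfold gg
    rw [key, key']
    refine le_trans (le_of_eq ?_) (this.trans (le_of_eq ?_))
    · congr 1; ring
    · field_simp




/-- Heat flow at time `s`. -/
noncomputable def us (v : NNReal) (g : ℝ → ℝ) (s : ℕ) (z : ℝ) : ℝ :=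
  ∫ w, g (w + z) ∂(ProbabilityTheory.gaussianReal 0 ((s : NNReal) * v))

lemma bi (μ : Measure ℝ) [IsProbabilityMeasure μ] (h : ℝ → ℝ) (hc : Continuous h) (M : ℝ)
    (hM : ∀ z, |h z| ≤ M) (z : ℝ) : Integrable (fun w => h (w + z)) μ := by
  refine Integrable.of_bound (by fun_prop) M ?_
  exact ae_of_all _ fun w => hM _

lemma int_le (μ : Measure ℝ) [IsProbabilityMeasure μ] (h : ℝ → ℝ) (M : ℝ)
    (hM : ∀ z, |h z| ≤ M) : |∫ w, h w ∂μ| ≤ M := by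
  have := norm_integral_le_of_norm_le_const (μ := μ) (f := h) (C := M) (ae_of_all _ hM)
  simpa using this

lemma isub {μ : Measure ℝ} {f g : ℝ → ℝ} (hf : Integrable f μ) (hg : Integrable g μ) :
    Integrable (fun w => f w - g w) μ := hf.sub hg

lemma us_succ (v : NNReal) (g : ℝ → ℝ) (hc : Continuous g) (M : ℝ) (hM : ∀ z, |g z| ≤ M)
    (s : ℕ) (z : ℝ) : us v g (s + 1) z =
      ∫ w, us v g s (z + w) ∂(ProbabilityTheory.gaussianReal 0 v) := by
  unfold us
  have e : ProbabilityTheory.gaussianReal 0 (((s + 1 : ℕ) : NNReal) * v) =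
      (ProbabilityTheory.gaussianReal 0 v).conv
        (ProbabilityTheory.gaussianReal 0 ((s : NNReal) * v)) := by
    rw [ProbabilityTheory.gaussianReal_conv_gaussianReal]
    congr 1
    · simp
    · push_cast; ring
  have hi := bi (ProbabilityTheory.gaussianReal 0 (((s + 1 : ℕ) : NNReal) * v)) g hc M hM z
  rw [e] at hi ⊢
  rw [integral_conv hi]
  congr 1; funext w; congr 1; funext w'; congr 1; ring

lemma us_cont (v : NNReal) (g : ℝ → ℝ) (hc : Continuous g) (M : ℝ) (hM : ∀ z, |g z| ≤ M)
    (s : ℕ) : Continuous (us v g s) := by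
  unfold us
  refine continuous_of_dominated (bound := fun _ => M) (fun z => by fun_prop)
    (fun z => ae_of_all _ fun w => hM _) (integrable_const _) (ae_of_all _ fun w => by fun_prop)

lemma us_tri (v : NNReal) {A1 A2 A3 : ℝ} {g g1 g2 : ℝ → ℝ} (T : Tri A1 A2 A3 g g1 g2) (s : ℕ) :
    Tri A1 A2 A3 (us v g s) (us v g1 s) (us v g2 s) := by
  set μ := ProbabilityTheory.gaussianReal 0 ((s : NNReal) * v) with hμ
  have i0 := bi μ g T.c0 _ T.b0
  have i1 := bi μ g1 T.c1 _ T.b1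
  have i2 := bi μ g2 T.c2 _ T.b2
  refine ⟨us_cont v g T.c0 _ T.b0 s, us_cont v g1 T.c1 _ T.b1 s, us_cont v g2 T.c2 _ T.b2 s,
    fun z => int_le μ _ _ fun w => T.b0 _, fun z => int_le μ _ _ fun w => T.b1 _,
    fun z => int_le μ _ _ fun w => T.b2 _, ?_, ?_, ?_, ?_, ?_⟩
  · intro z d
    have := int_le μ (fun w => g (w + (z + d)) - g (w + z) - g1 (w + z) * d - g2 (w + z) * d ^ 2 / 2)
      _ (fun w => by rw [← add_assoc]; exact T.t3 _ d)
    rwa [integral_sub (isub (isub (i0 _) (i0 _)) ((i1 _).mul_const _))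
      (((i2 _).mul_const _).div_const _), integral_sub (isub (i0 _) (i0 _)) ((i1 _).mul_const _),
      integral_sub (i0 _) (i0 _), integral_div, integral_mul_const, integral_mul_const] at this
  · intro z d
    have := int_le μ (fun w => g1 (w + (z + d)) - g1 (w + z) - g2 (w + z) * d)
      _ (fun w => by rw [← add_assoc]; exact T.t21 _ d)
    rwa [integral_sub (isub (i1 _) (i1 _)) ((i2 _).mul_const _),
      integral_sub (i1 _) (i1 _), integral_mul_const] at this
  · intro z d
    have := int_le μ (fun w => g2 (w + (z + d)) - g2 (w + z))
      _ (fun w => by rw [← add_assoc]; exact T.t2 _ d)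
    rwa [integral_sub (i2 _) (i2 _)] at this
  · intro z d
    have := int_le μ (fun w => g (w + (z + d)) - g (w + z) - g1 (w + z) * d)
      _ (fun w => by rw [← add_assoc]; exact T.t1 _ d)
    rwa [integral_sub (isub (i0 _) (i0 _)) ((i1 _).mul_const _),
      integral_sub (i0 _) (i0 _), integral_mul_const] at this
  · intro z d
    have := int_le μ (fun w => g (w + (z + d)) - g (w + z))
      _ (fun w => by rw [← add_assoc]; exact T.l1 _ d)
    rwa [integral_sub (i0 _) (i0 _)] at this

lemma us_zero (v : NNReal) (g : ℝ → ℝ) : us v g 0 = g := by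
  funext z
  simp [us, ProbabilityTheory.gaussianReal_zero_var]

lemma us_odd (v : NNReal) (g : ℝ → ℝ) (hg : Measurable g) (ho : ∀ w, g (-w) = - g w) (s : ℕ) :
    us v g s 0 = 0 := by
  have h := ProbabilityTheory.gaussianReal_map_neg (μ := 0) (v := (s : NNReal) * v)
  rw [neg_zero] at h
  have : us v g s 0 = - us v g s 0 := by
    unfold us
    conv_lhs => rw [← h]
    rw [integral_map (by fun_prop) (by
      have : Measurable fun w => g (w + 0) := by fun_prop
      exact this.aestronglyMeasurable), ← integral_neg]
    simp [ho]
  linarith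

/-- Moment constant of the Gaussian law. -/
noncomputable def mom (v : NNReal) : ℝ :=
  (∫ w, |w| ∂(ProbabilityTheory.gaussianReal 0 v)) + v +
    ∫ w, |w| ^ 3 ∂(ProbabilityTheory.gaussianReal 0 v)

lemma mom_int (v : NNReal) (k : ℕ) :
    Integrable (fun w : ℝ => |w| ^ k) (ProbabilityTheory.gaussianReal 0 v) := by
  rcases Nat.eq_zero_or_pos k with rfl | hk
  · simp
  · have := (ProbabilityTheory.memLp_id_gaussianReal (μ := 0) (v := v) (k : NNReal)).integrable_norm_pow
      (p := k) (by omega)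
    simpa using this

lemma sq_int (v : NNReal) : ∫ w, w ^ 2 ∂(ProbabilityTheory.gaussianReal 0 v) = v := by
  have h := ProbabilityTheory.variance_fun_id_gaussianReal (μ := 0) (v := v)
  rw [ProbabilityTheory.variance_of_integral_eq_zero (by fun_prop)
    ProbabilityTheory.integral_id_gaussianReal] at h
  exact h

lemma us_useq (v : NNReal) {A1 A2 A3 : ℝ} {g g1 g2 : ℝ → ℝ} (T : Tri A1 A2 A3 g g1 g2)
    (ho : ∀ w, g (-w) = - g w) :
    USeq (v : ℝ) (mom v) A1 A2 A3 (us v g) (us v g1) (us v g2) := by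
  have Ts := us_tri v T
  set μ := ProbabilityTheory.gaussianReal 0 v with hμ
  have m1 : Integrable (fun w : ℝ => |w|) μ := by simpa using mom_int v 1
  have m2 : Integrable (fun w : ℝ => w ^ 2) μ := by simpa using mom_int v 2
  have m3 : Integrable (fun w : ℝ => |w| ^ 3) μ := mom_int v 3
  have mid : Integrable (fun w : ℝ => w) μ := by
    refine m1.mono (by fun_prop) (ae_of_all _ fun w => by simp)
  have e1 : 0 ≤ ∫ w, |w| ∂μ := integral_nonneg fun w => abs_nonneg w
  have e3 : 0 ≤ ∫ w, |w| ^ 3 ∂μ := integral_nonneg fun w => pow_nonneg (abs_nonneg w) 3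
  have e2 : (0:ℝ) ≤ v := v.2
  have hA3 : 0 ≤ A3 := by have := T.t2 0 1; simp at this; exact (abs_nonneg _).trans this
  have j : ∀ h : ℝ → ℝ, Continuous h → ∀ M, (∀ z, |h z| ≤ M) → ∀ z, Integrable (fun w => h (z + w)) μ :=
    fun h hc M hM z => by simpa only [add_comm] using bi μ h hc M hM z
  refine ⟨(abs_nonneg _).trans (T.b1 0), (abs_nonneg _).trans (T.b2 0), hA3, ?_,
    fun s => (Ts s).t3, fun s => (Ts s).t2, fun s => (Ts s).b2, ?_, ?_, ?_, ?_, ?_⟩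
  · unfold mom; linarith
  · intro s z
    have := (Ts s).t1 0 z
    rwa [us_odd v g T.c0.measurable ho, zero_add, sub_zero] at this
  · intro z d; rw [us_zero]; exact T.l1 z d
  · intro s z
    rw [us_succ v g T.c0 _ T.b0]
    have i0 := j _ (Ts s).c0 _ (Ts s).b0 z
    have key : (∫ w, us v g s (z + w) ∂μ) - us v g s z - v / 2 * us v g2 s z =
        ∫ w, (us v g s (z + w) - us v g s z - us v g1 s z * w - us v g2 s z * w ^ 2 / 2) ∂μ := by
      rw [integral_sub (isub (isub i0 (integrable_const _)) (mid.const_mul _))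
        ((m2.const_mul _).div_const _), integral_sub (isub i0 (integrable_const _)) (mid.const_mul _),
        integral_sub i0 (integrable_const _), integral_div, integral_const_mul, integral_const_mul,
        sq_int, ProbabilityTheory.integral_id_gaussianReal]
      simp; ring
    rw [key, ← Real.norm_eq_abs]
    calc _ ≤ ∫ w, A3 * |w| ^ 3 ∂μ := norm_integral_le_of_norm_le (m3.const_mul _)
            (ae_of_all _ fun w => (Ts s).t3 z w)
      _ = A3 * ∫ w, |w| ^ 3 ∂μ := integral_const_mul _ _
      _ ≤ mom v * A3 := by
        rw [mul_comm]; refine mul_le_mul_of_nonneg_right ?_ hA3; unfold mom; linarith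
  · intro s
    rw [us_succ v g1 T.c1 _ T.b1]
    have i0 := j _ (Ts s).c1 _ (Ts s).b1 0
    have key : (∫ w, us v g1 s (0 + w) ∂μ) - us v g1 s 0 =
        ∫ w, (us v g1 s (0 + w) - us v g1 s 0 - us v g2 s 0 * w) ∂μ := by
      rw [integral_sub (isub i0 (integrable_const _)) (mid.const_mul _),
        integral_sub i0 (integrable_const _), integral_const_mul,
        ProbabilityTheory.integral_id_gaussianReal]
      simp
    rw [key, ← Real.norm_eq_abs]
    calc _ ≤ ∫ w, A3 * w ^ 2 ∂μ := norm_integral_le_of_norm_le (m2.const_mul _)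
            (ae_of_all _ fun w => (Ts s).t21 0 w)
      _ = A3 * v := by rw [integral_const_mul, sq_int]
      _ ≤ mom v * A3 := by
        rw [mul_comm]; refine mul_le_mul_of_nonneg_right ?_ hA3; unfold mom; linarith
  · intro s z
    rw [us_succ v g2 T.c2 _ T.b2]
    have i0 := j _ (Ts s).c2 _ (Ts s).b2 z
    have key : (∫ w, us v g2 s (z + w) ∂μ) - us v g2 s z =
        ∫ w, (us v g2 s (z + w) - us v g2 s z) ∂μ := by
      rw [integral_sub i0 (integrable_const _)]
      simp
    rw [key, ← Real.norm_eq_abs]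
    calc _ ≤ ∫ w, A3 * |w| ∂μ := norm_integral_le_of_norm_le (m1.const_mul _)
            (ae_of_all _ fun w => (Ts s).t2 z w)
      _ = A3 * ∫ w, |w| ∂μ := integral_const_mul _ _
      _ ≤ mom v * A3 := by
        rw [mul_comm]; refine mul_le_mul_of_nonneg_right ?_ hA3; unfold mom; linarith




/-- Gaussian density at time `n`. -/
noncomputable def pp (σ2 : ℝ) (n : ℕ) (b : ℝ) : ℝ :=
  Real.exp (-b ^ 2 / (2 * (n * σ2))) / (Real.sqrt σ2 * Real.sqrt (2 * π * n))

lemma pdf_eq (v : NNReal) (n : ℕ) (b : ℝ) :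
    ProbabilityTheory.gaussianPDFReal 0 ((n : NNReal) * v) b = pp (v : ℝ) n b := by
  unfold ProbabilityTheory.gaussianPDFReal pp
  rw [← Real.sqrt_mul (NNReal.coe_nonneg v)]
  push_cast
  rw [sub_zero, show (v : ℝ) * (2 * π * n) = 2 * π * (n * v) by ring, inv_mul_eq_div]

lemma pp_even (σ2 : ℝ) (n : ℕ) (b : ℝ) : pp σ2 n (-b) = pp σ2 n b := by simp [pp]

lemma pp_lip (σ2 : ℝ) (hσ : 0 < σ2) (n : ℕ) (hn : 1 ≤ n) (b d : ℝ) :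
    |pp σ2 n (b + d) - pp σ2 n b| ≤ 1 / (n * σ2) * |d| := by
  have hn' : (1:ℝ) ≤ n := by exact_mod_cast hn
  have ha : 0 < (n : ℝ) * σ2 := by positivity
  set a := (n : ℝ) * σ2 with hadef
  have hden : Real.sqrt σ2 * Real.sqrt (2 * π * n) = Real.sqrt (2 * π) * Real.sqrt a := by
    rw [← Real.sqrt_mul hσ.le, ← Real.sqrt_mul (by positivity)]; congr 1; rw [hadef]; ring
  unfold pp
  rw [hden]
  have hsa : 0 < Real.sqrt a := Real.sqrt_pos.2 ha
  have hpi : 1 ≤ Real.sqrt (2 * π) := by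
    rw [Real.one_le_sqrt]; nlinarith [Real.pi_gt_three]
  refine mv (fun b => Real.exp (-b ^ 2 / (2 * a)) / (Real.sqrt (2 * π) * Real.sqrt a))
    (fun b => Real.exp (-b ^ 2 / (2 * a)) * (-(2 * b) / (2 * a)) /
      (Real.sqrt (2 * π) * Real.sqrt a)) (fun t => ?_) b d _ (fun t _ => ?_)
  · have h1 : HasDerivAt (fun b : ℝ => -b ^ 2 / (2 * a)) (-(2 * t) / (2 * a)) t := by
      have := ((hasDerivAt_pow 2 t).neg).div_const (2 * a)
      exact this.congr_deriv (by simp)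
    exact h1.exp.div_const _
  · have hx : |t| * Real.exp (-t ^ 2 / (2 * a)) ≤ Real.sqrt a := by
      set x := |t| / Real.sqrt a with hx
      have e1 : t ^ 2 / (2 * a) = x ^ 2 / 2 := by
        rw [hx, div_pow, sq_abs, Real.sq_sqrt ha.le]; field_simp
      have e2 : x ≤ Real.exp (x ^ 2 / 2) := by
        have := Real.add_one_le_exp (x ^ 2 / 2)
        nlinarith [sq_nonneg (x - 1)]
      rw [neg_div, Real.exp_neg, e1, ← div_eq_mul_inv, div_le_iff₀ (Real.exp_pos _)]
      have : |t| = Real.sqrt a * x := by rw [hx]; field_simp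
      rw [this]; gcongr
    rw [abs_div, abs_mul, abs_of_pos (Real.exp_pos _), abs_of_pos (by positivity : 0 < Real.sqrt (2 * π) * Real.sqrt a), div_le_iff₀ (by positivity), abs_div, abs_neg, abs_mul, abs_of_pos (by positivity : 0 < 2 * a), abs_two]
    calc Real.exp (-t ^ 2 / (2 * a)) * (2 * |t| / (2 * a))
        = (|t| * Real.exp (-t ^ 2 / (2 * a))) / a := by field_simp
      _ ≤ Real.sqrt a / a := by gcongr
      _ = 1 / a * (1 * Real.sqrt a) := by ring
      _ ≤ _ := by gcongr

lemma th1_int : ∫ t, th1 t = 1 := by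
  have hi : Integrable th1 := th1_cd.continuous.integrable_of_hasCompactSupport th1_cs
  have := integral_of_hasDerivAt_of_tendsto (f := th) (f' := th1) (m := 0) (n := 1)
    (fun t => ((th_cd.differentiable (by norm_num)) t).hasDerivAt) hi
    (tendsto_const_nhds.congr' (by
      filter_upwards [eventually_le_atBot 0] with t ht
      exact (Real.smoothTransition.zero_of_nonpos ht).symm))
    (tendsto_const_nhds.congr' (by
      filter_upwards [eventually_ge_atTop 1] with t ht
      exact (Real.smoothTransition.one_of_one_le ht).symm))
  simpa using this

lemma q_int (b L : ℝ) (hL : 0 < L) : Integrable (fun w => th1 ((w - b) / L) / L) ∧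
    ∫ w, th1 ((w - b) / L) / L = 1 := by
  have hi : Integrable th1 := th1_cd.continuous.integrable_of_hasCompactSupport th1_cs
  constructor
  · exact (((hi.comp_div hL.ne').comp_sub_right b)).div_const L
  · rw [integral_div, integral_sub_right_eq_self (fun w => th1 (w / L)) b,
      Measure.integral_comp_div, th1_int, abs_of_pos hL]
    simp [hL.ne']

lemma u1_val (v : NNReal) (hv : 0 < v) (n : ℕ) (hn : 1 ≤ n) (b L : ℝ) (hL : 0 < L) :
    |us v (gg1 b L) n 0 - 2 * pp v n b| ≤ 2 * (L / (n * v)) := by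
  have hn' : (1:ℝ) ≤ n := by exact_mod_cast hn
  have hv' : (0:ℝ) < v := hv
  obtain ⟨qi, q1⟩ := q_int b L hL
  set q : ℝ → ℝ := fun w => th1 ((w - b) / L) / L with hq
  have hnv : (n : NNReal) * v ≠ 0 := by
    have : (n : NNReal) ≠ 0 := by exact_mod_cast (by omega : n ≠ 0)
    exact mul_ne_zero this hv.ne'
  have hd : ∀ w, |(pp v n w - pp v n b) * q w| ≤ L / (n * v) * q w := by
    intro w
    have hq0 : 0 ≤ q w := div_nonneg (th1_nonneg _) hL.le
    rw [abs_mul, abs_of_nonneg hq0]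
    by_cases hw : (w - b) / L < 0 ∨ 1 < (w - b) / L
    · simp [hq, th1_zero _ hw]
    · rw [not_or, not_lt, not_lt, le_div_iff₀ hL, div_le_iff₀ hL] at hw
      refine mul_le_mul_of_nonneg_right ?_ hq0
      have := pp_lip v hv' n hn b (w - b)
      rw [add_sub_cancel] at this
      refine this.trans ?_
      rw [abs_of_nonneg (by linarith), div_mul_eq_mul_div, one_mul]
      gcongr
      linarith
  have hm : Continuous (pp v n) := by unfold pp; fun_prop
  have hpq : Integrable (fun w => (pp v n w - pp v n b) * q w) := by
    refine (qi.const_mul (L / (n * v))).mono' ?_ (ae_of_all _ hd)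
    exact ((hm.sub continuous_const).aestronglyMeasurable).mul qi.aestronglyMeasurable
  have hpq' : Integrable (fun w => pp v n w * q w) := by
    have := hpq.add (qi.const_mul (pp v n b))
    refine this.congr (ae_of_all _ fun w => ?_)
    simp; ring
  have hneg : Integrable (fun w => pp v n w * q (-w)) := by
    have := hpq'.comp_neg
    simpa [pp_even] using this
  have e : us v (gg1 b L) n 0 = 2 * ∫ w, pp v n w * q w := by
    unfold us
    rw [ProbabilityTheory.integral_gaussianReal_eq_integral_smul hnv]
    have : ∀ w, ProbabilityTheory.gaussianPDFReal 0 ((n : NNReal) * v) w • gg1 b L (w + 0) =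
        pp v n w * q w + pp v n w * q (-w) := by
      intro w
      rw [pdf_eq, smul_eq_mul, add_zero, ← mul_add]
      simp only [hq, gg1]
      ring
    simp_rw [this]
    rw [integral_add hpq' hneg]
    have h2 : ∫ w, pp v n w * q (-w) = ∫ w, pp v n w * q w := by
      rw [← integral_neg_eq_self (fun w => pp v n w * q w)]
      simp_rw [pp_even]
    rw [h2]; ring
  have e2 : (∫ w, pp v n w * q w) - pp v n b = ∫ w, (pp v n w - pp v n b) * q w := by
    have : ∀ w, (pp v n w - pp v n b) * q w = pp v n w * q w - pp v n b * q w := fun w => by ring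
    simp_rw [this]
    rw [integral_sub hpq' (qi.const_mul _), integral_const_mul, q1, mul_one]
  have e3 : |(∫ w, pp v n w * q w) - pp v n b| ≤ L / (n * v) := by
    rw [e2, ← Real.norm_eq_abs]
    refine (norm_integral_le_of_norm_le (qi.const_mul _) (ae_of_all _ hd)).trans ?_
    rw [integral_const_mul, q1, mul_one]
  rw [e, ← mul_sub, abs_mul, abs_two]
  gcongr

lemma pp_nonneg (σ2 : ℝ) (n : ℕ) (b : ℝ) : 0 ≤ pp σ2 n b := by unfold pp; positivity

lemma pp_le_zero (σ2 : ℝ) (hσ : 0 < σ2) (n : ℕ) (b : ℝ) : pp σ2 n b ≤ pp σ2 n 0 := by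
  unfold pp
  refine div_le_div_of_nonneg_right (Real.exp_le_exp.2 ?_) (by positivity)
  have : 0 ≤ b ^ 2 / (2 * (n * σ2)) := by positivity
  simp only [neg_div]
  simpa using this

lemma pp_zero (σ2 : ℝ) (n : ℕ) :
    pp σ2 n 0 = 1 / (Real.sqrt σ2 * Real.sqrt (2 * π)) * (1 / Real.sqrt n) := by
  unfold pp
  rw [Real.sqrt_mul (by positivity)]
  simp; ring




/-- Sixteenth root of `n`. -/
noncomputable def qq (n : ℕ) : ℝ := (n : ℝ) ^ ((1:ℝ) / 16)

lemma qq_pow (n : ℕ) : qq n ^ 16 = n := by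
  unfold qq
  rw [← Real.rpow_natCast, ← Real.rpow_mul (by positivity)]
  norm_num

lemma qq_nonneg (n : ℕ) : 0 ≤ qq n := by unfold qq; positivity

lemma qq_one_le (n : ℕ) (hn : 1 ≤ n) : 1 ≤ qq n :=
  Real.one_le_rpow (by exact_mod_cast hn) (by norm_num)

lemma qq_sqrt (n : ℕ) : Real.sqrt n = qq n ^ 8 := by
  rw [← qq_pow n, show qq n ^ 16 = (qq n ^ 8) ^ 2 by ring, Real.sqrt_sq (pow_nonneg (qq_nonneg n) 8)]

/-- quadratic weight -/
noncomputable def EE (y : ℝ) : ℝ := 1 + max y 0 ^ 2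

lemma EE_one (y : ℝ) : 1 ≤ EE y := by unfold EE; nlinarith [sq_nonneg (max y 0)]
lemma EE_lin (y : ℝ) : 1 + max y 0 ≤ 2 * EE y := by
  unfold EE; nlinarith [sq_nonneg (max y 0 - 1), sq_nonneg (max y 0)]

section
variable [Fintype X] {P : X → X → ℝ} {f r ρ : X → ℝ} {σ2 K : ℝ}

lemma D_le (S : Setup P f r ρ σ2 K) (n : ℕ) (x : X) (y : ℝ) (hy : -K ≤ y) :
    |(Tl P f ^ n) (zet r) x y| ≤ 10 * K * EE y := by
  have h := D_bound S n x y hy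
  have := EE_lin y
  have hK := S.hK
  nlinarith

lemma test_bound (S : Setup P f r ρ σ2 K) : ∃ C : ℝ, 1 ≤ C ∧ ∀ (b : ℝ) (n : ℕ) (x : X) (y : ℝ),
    1 ≤ n → -K ≤ y →
    |(Tl P f ^ n) (fun _ y => gg b (qq n ^ 6) y) x y - 2 * pp σ2 n b * (Tl P f ^ n) (zet r) x y|
      ≤ C * EE y / qq n ^ 9 := by
  have hσ := S.hσ
  have hK := S.hK
  set v : NNReal := ⟨σ2, hσ.le⟩ with hv
  have hvv : (v : ℝ) = σ2 := rfl
  have hv0 : 0 < v := hσ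
  obtain ⟨Ct, hCt, T⟩ := th_tri
  have hmom : 0 ≤ mom v := (us_useq v (gg_tri T 0 1 one_pos) (gg_odd 0 1)).C0n
  obtain ⟨C, hC, hexp⟩ := expansion' S (mom v) hmom
  refine ⟨6 * C * Ct + 20 * K / σ2, ?_, ?_⟩
  · have : 0 ≤ 20 * K / σ2 := by positivity
    nlinarith
  intro b n x y hn hy
  have hq := qq_one_le n hn
  have hq0 : 0 < qq n := by linarith
  have hnq := qq_pow n
  have hsq := qq_sqrt n
  set q := qq n with hqd
  have hL : 0 < q ^ 6 := by positivity
  have h1 := hexp _ _ _ _ _ _ (us_useq v (gg_tri T b (q ^ 6) hL) (gg_odd b (q ^ 6))) n x y hn hy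
  rw [us_zero] at h1
  have h2 := u1_val v hv0 n hn b (q ^ 6) hL
  rw [hvv, ← hnq] at h2
  rw [hsq] at h1
  have hD := D_le S n x y hy
  have hE := EE_one y
  set D := (Tl P f ^ n) (zet r) x y with hDd
  set A := (Tl P f ^ n) (fun _ y => gg b (q ^ 6) y) x y
  set U := us v (gg1 b (q ^ 6)) n 0
  have h3 : |A - 2 * pp σ2 n b * D| ≤ |A - U * D| + |U - 2 * pp σ2 n b| * |D| := by
    rw [← abs_mul]
    refine le_trans (le_of_eq ?_) (abs_add_le _ _)
    congr 1; ring
  refine h3.trans ?_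
  have hp : ∀ k : ℕ, 9 ≤ k → 1 / q ^ k ≤ 1 / q ^ 9 := fun k hk => by
    apply one_div_le_one_div_of_le (by positivity)
    exact pow_le_pow_right₀ hq hk
  have e1 : 2 * Ct / (q ^ 6) ^ 3 * q ^ 8 + 2 * Ct / (q ^ 6) ^ 2 + 2 * Ct / q ^ 6 / q ^ 8 ≤
      6 * Ct * (1 / q ^ 9) := by
    have : 2 * Ct / (q ^ 6) ^ 3 * q ^ 8 + 2 * Ct / (q ^ 6) ^ 2 + 2 * Ct / q ^ 6 / q ^ 8 =
      2 * Ct * (1 / q ^ 10) + 2 * Ct * (1 / q ^ 12) + 2 * Ct * (1 / q ^ 14) := by field_simp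
    rw [this]
    nlinarith [hp 10 (by norm_num), hp 12 (by norm_num), hp 14 (by norm_num)]
  have e2 : 2 * (q ^ 6 / (q ^ 16 * σ2)) ≤ 2 / σ2 * (1 / q ^ 9) := by
    have : 2 * (q ^ 6 / (q ^ 16 * σ2)) = 2 / σ2 * (1 / q ^ 10) := by field_simp
    rw [this]
    gcongr
    norm_num
  have hE0 : 0 ≤ EE y := by linarith
  calc _ ≤ C * EE y * (6 * Ct * (1 / q ^ 9)) + 2 / σ2 * (1 / q ^ 9) * (10 * K * EE y) := by
        refine add_le_add (h1.trans ?_) (mul_le_mul (h2.trans ?_) hD (abs_nonneg _) (by positivity))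
        · exact mul_le_mul_of_nonneg_left e1 (by positivity)
        · exact e2
    _ = _ := by ring

set_option maxHeartbeats 2000000 in
lemma upper0 (S : Setup P f r ρ σ2 K) : ∃ C : ℝ, 1 ≤ C ∧ ∀ (n : ℕ) (x : X) (y : ℝ),
    1 ≤ n → -K ≤ y →
    (Tl P f ^ n) 1 x y ≤ 2 * pp σ2 n 0 * (Tl P f ^ n) (zet r) x y + C * EE y / qq n ^ 9 := by
  have hσ := S.hσ
  have hK := S.hK
  obtain ⟨C1, hC1, htest⟩ := test_bound S
  obtain ⟨C2, hC2, -, hcr⟩ := crude S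
  set c := 1 / (Real.sqrt σ2 * Real.sqrt (2 * π)) with hc
  have hc0 : 0 ≤ c := by positivity
  refine ⟨512 + 512 * C1 + 20 * K * c * 512 + 16 * C2 ^ 2 + 160 * K * c + 48 * K * c * C2, ?_, ?_⟩
  · have : 0 ≤ K * c := by positivity
    have : 0 ≤ K * c * C2 := by positivity
    nlinarith [sq_nonneg C2]
  intro n x y hn hy
  have hq := qq_one_le n hn
  have hq0 : 0 < qq n := by linarith
  have hnq := qq_pow n
  have hsq := qq_sqrt n
  have hE := EE_one y
  have hEl := EE_lin y
  have hE0 : 0 ≤ EE y := by linarith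
  have hp0 : pp σ2 n 0 = c * (1 / qq n ^ 8) := by rw [pp_zero, hsq]
  by_cases hbig : qq n < 2
  · have a1 : (Tl P f ^ n) 1 x y ≤ 1 := Tn_one_le_one S n x y hy
    have a2 := (abs_le.1 (D_le S n x y hy)).1
    have a3 : (1:ℝ) ≤ 512 / qq n ^ 9 := by
      rw [le_div_iff₀ (by positivity), one_mul]
      calc qq n ^ 9 ≤ 2 ^ 9 := by gcongr
        _ = _ := by norm_num
    have a4 : pp σ2 n 0 ≤ c := by
      rw [hp0]
      have : 1 / qq n ^ 8 ≤ 1 := by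
        rw [div_le_one (by positivity)]; exact one_le_pow₀ hq
      nlinarith
    have a5 := pp_nonneg σ2 n 0
    have a6 : -(20 * K * c * EE y) ≤ 2 * pp σ2 n 0 * (Tl P f ^ n) (zet r) x y := by
      have : pp σ2 n 0 * (10 * K * EE y) ≤ c * (10 * K * EE y) := by gcongr
      nlinarith
    have a7 : EE y * (1 + 20 * K * c) ≤ EE y * (1 + 20 * K * c) * (512 / qq n ^ 9) := by
      have : 0 ≤ EE y * (1 + 20 * K * c) := by positivity
      nlinarith
    have a8 : EE y * (1 + 20 * K * c) * (512 / qq n ^ 9) ≤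
      (512 + 512 * C1 + 20 * K * c * 512 + 16 * C2 ^ 2 + 160 * K * c + 48 * K * c * C2) * EE y / qq n ^ 9 := by
      rw [mul_div_assoc', mul_comm (EE y), mul_right_comm]
      gcongr
      have : 0 ≤ 512 * C1 + 16 * C2 ^ 2 + 160 * K * c + 48 * K * c * C2 := by positivity
      linarith
    linarith
  · rw [not_lt] at hbig
    set q := qq n with hqd
    -- choice of the last block
    set l := ⌈q ^ 14⌉₊ with hl
    have l1 : q ^ 14 ≤ (l : ℝ) := Nat.le_ceil _
    have l2 : (l : ℝ) ≤ 2 * q ^ 14 := by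
      have h := Nat.ceil_lt_add_one (a := q ^ 14) (by positivity)
      have h2 : 1 ≤ q ^ 14 := one_le_pow₀ hq
      linarith
    have l3 : 2 * q ^ 14 ≤ q ^ 16 / 2 := by
      have : 4 ≤ q ^ 2 := by nlinarith
      have h14 : 0 ≤ q ^ 14 := by positivity
      nlinarith
    have l4 : 1 ≤ l := by
      have : (1:ℝ) ≤ l := (one_le_pow₀ hq).trans l1
      exact_mod_cast this
    have l5 : l < n := by
      have : (l:ℝ) < n := by
        rw [← hnq]
        have : 0 < q ^ 16 := by positivity
        linarith
      exact_mod_cast this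
    obtain ⟨m, hm⟩ : ∃ m, n = m + l := ⟨n - l, by omega⟩
    have m1 : 1 ≤ m := by omega
    have hmn : m ≤ n := by omega
    have mR : (m : ℝ) = n - l := by rw [hm]; push_cast; ring
    have m2 : q ^ 16 / 2 ≤ m := by rw [mR, ← hnq]; linarith
    have hmq := qq_pow m
    have hmsq := qq_sqrt m
    have pq := qq_one_le m m1
    set p := qq m with hpd
    have pq2 : q / 2 ≤ p := by
      refine le_of_pow_le_pow_left₀ (n := 16) (by norm_num) (by linarith) ?_
      rw [hmq, div_pow]
      refine le_trans ?_ m2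
      have : 0 ≤ q ^ 16 := by positivity
      norm_num
      linarith
    have pq1 : p ≤ q := by
      refine le_of_pow_le_pow_left₀ (n := 16) (by norm_num) (by linarith) ?_
      rw [hmq, hnq]; exact_mod_cast hmn
    have p8 : q ^ 8 / 2 ≤ p ^ 8 := by
      refine le_of_pow_le_pow_left₀ (n := 2) (by norm_num) (by positivity) ?_
      rw [← pow_mul, hmq, div_pow, ← pow_mul]
      refine le_trans ?_ m2
      have : 0 ≤ q ^ 16 := by positivity
      norm_num
      linarith
    have hL : 0 < p ^ 6 := by positivity
    -- the inner estimate
    have inner : ∀ x' y', 0 < y' → (Tl P f ^ l) 1 x' y' ≤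
        ((fun _ y => gg 0 (p ^ 6) y) + (2 * C2 / q) • (1 : X → ℝ → ℝ) : X → ℝ → ℝ) x' y' := by
      intro x' y' hy'
      have hyK : -K ≤ y' := by linarith
      simp only [Pi.add_apply, Pi.smul_apply, Pi.one_apply, smul_eq_mul, mul_one]
      by_cases hyL : p ^ 6 ≤ y'
      · rw [gg_one 0 _ _ le_rfl hL (by linarith)]
        have := Tn_one_le_one S l x' y' hyK
        have : 0 ≤ 2 * C2 / q := by positivity
        linarith
      · rw [not_le] at hyL
        have g0 := gg_nonneg 0 (p ^ 6) y' le_rfl hL hy'.le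
        have h1 := hcr l x' y' l4 hyK
        rw [max_eq_left hy'.le] at h1
        have h2 : 1 + y' ≤ 2 * q ^ 6 := by
          have : p ^ 6 ≤ q ^ 6 := by gcongr
          have : 1 ≤ q ^ 6 := one_le_pow₀ hq
          linarith
        have h3 : q ^ 7 ≤ Real.sqrt l := by
          apply Real.le_sqrt_of_sq_le
          rw [← pow_mul]; exact l1
        have h4 : C2 * (1 + y') / Real.sqrt l ≤ C2 * (2 * q ^ 6) / q ^ 7 := by gcongr
        have h5 : C2 * (2 * q ^ 6) / q ^ 7 = 2 * C2 / q := by field_simp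
        linarith
    have step := Tn_mono_pos S inner m m1 x y
    rw [← Module.End.mul_apply, ← pow_add, ← hm, map_add, map_smul] at step
    simp only [Pi.add_apply, Pi.smul_apply, smul_eq_mul] at step
    have ht := (abs_le.1 (htest 0 m x y m1 hy)).2
    have hcm := hcr m x y m1 hy
    rw [hmsq] at hcm
    have hDm := D_le S m x y hy
    have hdd := D_diff S hmn x y hy
    have hn1 := Tn_one_nonneg S n x y hy
    have hp0m : pp σ2 m 0 = c * (1 / p ^ 8) := by rw [pp_zero, hmsq]
    rw [hp0m] at ht
    rw [hp0]
    have hp8 : 0 < p ^ 8 := by positivity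
    have i1 : 1 / p ^ 8 ≤ 2 / q ^ 8 := by
      rw [div_le_div_iff₀ hp8 (by positivity)]; linarith
    have i2 : 1 / p ^ 9 ≤ 512 / q ^ 9 := by
      have : (q / 2) ^ 9 ≤ p ^ 9 := by gcongr
      rw [div_pow] at this
      rw [div_le_div_iff₀ (by positivity) (by positivity)]
      norm_num at this
      linarith
    have i3 : 1 / p ^ 8 - 1 / q ^ 8 ≤ 4 / q ^ 10 := by
      have e : (1 / p ^ 8 - 1 / q ^ 8) = (l:ℝ) * (1 / p ^ 8) * (1 / (q ^ 8 * (p ^ 8 + q ^ 8))) := by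
        have : (l:ℝ) = q ^ 16 - p ^ 16 := by rw [hnq, hmq, mR]; ring
        rw [this]; field_simp; ring
      rw [e]
      have e2 : 1 / (q ^ 8 * (p ^ 8 + q ^ 8)) ≤ 1 / q ^ 16 := by
        apply one_div_le_one_div_of_le (by positivity)
        have : 0 ≤ q ^ 8 * p ^ 8 := by positivity
        nlinarith
      calc _ ≤ (2 * q ^ 14) * (2 / q ^ 8) * (1 / q ^ 16) := by gcongr
        _ = _ := by field_simp; norm_num
    have i3' : 0 ≤ 1 / p ^ 8 - 1 / q ^ 8 := by
      rw [sub_nonneg]; gcongr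
    have hpw : ∀ k : ℕ, 9 ≤ k → 1 / q ^ k ≤ 1 / q ^ 9 := fun k hk => by
      apply one_div_le_one_div_of_le (by positivity)
      exact pow_le_pow_right₀ hq hk
    set Dm := (Tl P f ^ m) (zet r) x y
    set Dn := (Tl P f ^ n) (zet r) x y
    set Om := (Tl P f ^ m) 1 x y
    have hOm : Om ≤ 4 * C2 * EE y * (1 / q ^ 8) := by
      calc Om ≤ C2 * (1 + max y 0) / p ^ 8 := hcm
        _ = C2 * (1 + max y 0) * (1 / p ^ 8) := by ring
        _ ≤ C2 * (2 * EE y) * (2 / q ^ 8) := by gcongr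
        _ = _ := by ring
    have j1 : 2 * C2 / q * Om ≤ 8 * C2 ^ 2 * EE y * (1 / q ^ 9) := by
      calc _ ≤ 2 * C2 / q * (4 * C2 * EE y * (1 / q ^ 8)) := by gcongr
        _ = _ := by field_simp; norm_num
    have j2 : C1 * EE y / p ^ 9 ≤ 512 * C1 * EE y * (1 / q ^ 9) := by
      calc _ = C1 * EE y * (1 / p ^ 9) := by ring
        _ ≤ C1 * EE y * (512 / q ^ 9) := by gcongr
        _ = _ := by ring
    have j3 : (1 / p ^ 8 - 1 / q ^ 8) * Dm ≤ 40 * K * EE y * (1 / q ^ 9) := by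
      calc _ ≤ (1 / p ^ 8 - 1 / q ^ 8) * (10 * K * EE y) :=
            mul_le_mul_of_nonneg_left ((le_abs_self _).trans hDm) i3'
        _ ≤ 4 / q ^ 10 * (10 * K * EE y) := by gcongr
        _ = 40 * K * EE y * (1 / q ^ 10) := by ring
        _ ≤ _ := by gcongr; norm_num
    have j4 : 1 / q ^ 8 * (Dm - Dn) ≤ 12 * K * C2 * EE y * (1 / q ^ 9) := by
      have : Dm - Dn ≤ 3 * K * (4 * C2 * EE y * (1 / q ^ 8)) := by
        refine (le_abs_self _).trans (hdd.trans ?_)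
        gcongr
        linarith
      calc _ ≤ 1 / q ^ 8 * (3 * K * (4 * C2 * EE y * (1 / q ^ 8))) := by gcongr
        _ = 12 * K * C2 * EE y * (1 / q ^ 16) := by field_simp; norm_num
        _ ≤ _ := by
          have := hpw 16 (by norm_num)
          gcongr
    have k1 : 2 * (c * (1 / p ^ 8)) * Dm - 2 * (c * (1 / q ^ 8)) * Dn =
      2 * c * ((1 / p ^ 8 - 1 / q ^ 8) * Dm + 1 / q ^ 8 * (Dm - Dn)) := by ring
    have k2 : 2 * c * ((1 / p ^ 8 - 1 / q ^ 8) * Dm + 1 / q ^ 8 * (Dm - Dn)) ≤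
      2 * c * (40 * K * EE y * (1 / q ^ 9) + 12 * K * C2 * EE y * (1 / q ^ 9)) := by
      gcongr
    have k3 : (512 + 512 * C1 + 20 * K * c * 512 + 16 * C2 ^ 2 + 160 * K * c + 48 * K * c * C2) *
        EE y / q ^ 9 =
        512 * C1 * EE y * (1 / q ^ 9) + 8 * C2 ^ 2 * EE y * (1 / q ^ 9) +
        2 * c * (40 * K * EE y * (1 / q ^ 9) + 12 * K * C2 * EE y * (1 / q ^ 9)) +
        (512 + 20 * K * c * 512 + 8 * C2 ^ 2 + 80 * K * c + 24 * K * c * C2) * EE y / q ^ 9 := by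
      ring
    have k4 : 0 ≤ (512 + 20 * K * c * 512 + 8 * C2 ^ 2 + 80 * K * c + 24 * K * c * C2) * EE y / q ^ 9 := by
      positivity
    linarith

end



/-- Indicator of the half line above `b`. -/
noncomputable def Hb (X : Type*) (b : ℝ) : X → ℝ → ℝ := fun _ y => if b < y then 1 else 0

section
variable [Fintype X] {P : X → X → ℝ} {f r ρ : X → ℝ} {σ2 K : ℝ}

lemma main_bound (S : Setup P f r ρ σ2 K) : ∃ C : ℝ, 1 ≤ C ∧ ∀ (b : ℝ) (n : ℕ) (x : X) (y : ℝ),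
    0 ≤ b → 1 ≤ n → -K ≤ y →
    |(Tl P f ^ n) (Hb X b) x y - 2 * pp σ2 n b * (Tl P f ^ n) (zet r) x y|
      ≤ C * EE y / qq n ^ 9 := by
  have hσ := S.hσ
  have hK := S.hK
  obtain ⟨C1, hC1, htest⟩ := test_bound S
  obtain ⟨C2, hC2, hup⟩ := upper0 S
  refine ⟨C1 + C2 + 20 * K / σ2, ?_, ?_⟩
  · have : 0 ≤ 20 * K / σ2 := by positivity
    linarith
  intro b n x y hb hn hy
  have hq := qq_one_le n hn
  have hnq := qq_pow n
  have hE0 : 0 ≤ EE y := by linarith [EE_one y]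
  set q := qq n with hqd
  have hL : 0 < q ^ 6 := by positivity
  set D := (Tl P f ^ n) (zet r) x y with hD
  have hDle := D_le S n x y hy
  rw [← hD] at hDle
  have hsplit : (C1 + C2 + 20 * K / σ2) * EE y / q ^ 9 =
    C1 * EE y / q ^ 9 + C2 * EE y / q ^ 9 + 20 * K / σ2 * EE y / q ^ 9 := by ring
  have s1 : 0 ≤ C1 * EE y / q ^ 9 := by positivity
  have s2 : 0 ≤ C2 * EE y / q ^ 9 := by positivity
  have s3 : 0 ≤ 20 * K / σ2 * EE y / q ^ 9 := by positivity
  -- shifting the level by at most one window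
  have shift : ∀ b' d, b' + d = b → |d| ≤ q ^ 6 → 2 * pp σ2 n b' * D - 2 * pp σ2 n b * D ≤
      20 * K / σ2 * EE y / q ^ 9 := by
    intro b' d hbd hd
    have h := pp_lip σ2 hσ n hn b' d
    rw [hbd, ← hnq] at h
    have h' : |pp σ2 n b - pp σ2 n b'| ≤ 1 / σ2 * (1 / q ^ 10) := by
      refine h.trans ?_
      calc 1 / (q ^ 16 * σ2) * |d| ≤ 1 / (q ^ 16 * σ2) * q ^ 6 := by gcongr
        _ = _ := by field_simp
    have h10 : 1 / q ^ 10 ≤ 1 / q ^ 9 := by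
      apply one_div_le_one_div_of_le (by positivity)
      exact pow_le_pow_right₀ hq (by norm_num)
    calc _ = 2 * (-((pp σ2 n b - pp σ2 n b') * D)) := by ring
      _ ≤ 2 * (|pp σ2 n b - pp σ2 n b'| * |D|) := by
        rw [← abs_mul]; gcongr; exact neg_le_abs _
      _ ≤ 2 * (1 / σ2 * (1 / q ^ 9) * (10 * K * EE y)) := by
        gcongr
        exact h'.trans (by gcongr)
      _ = _ := by ring
  rw [abs_le, hsplit]
  constructor
  · have h1 := (abs_le.1 (htest b n x y hn hy)).1
    rw [← hqd] at h1
    have h2 : (Tl P f ^ n) (fun _ y => gg b (q ^ 6) y) x y ≤ (Tl P f ^ n) (Hb X b) x y := by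
      refine Tn_mono_pos S (fun x' y' hy' => ?_) n hn x y
      unfold Hb
      split_ifs with h
      · exact gg_le_one b _ _ hb hL hy'.le
      · rw [gg_zero b _ _ hb hL hy'.le (not_lt.1 h)]
    linarith
  · by_cases hbL : q ^ 6 ≤ b
    · have h1 := (abs_le.1 (htest (b - q ^ 6) n x y hn hy)).2
      rw [← hqd] at h1
      have h2 : (Tl P f ^ n) (Hb X b) x y ≤ (Tl P f ^ n) (fun _ y => gg (b - q ^ 6) (q ^ 6) y) x y := by
        refine Tn_mono_pos S (fun x' y' hy' => ?_) n hn x y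
        unfold Hb
        split_ifs with h
        · rw [gg_one (b - q ^ 6) _ _ (by linarith) hL (by linarith)]
        · exact gg_nonneg _ _ _ (by linarith) hL hy'.le
      have h3 := shift (b - q ^ 6) (q ^ 6) (by ring) (by rw [abs_of_pos hL])
      linarith
    · have h1 := hup n x y hn hy
      have h2 : (Tl P f ^ n) (Hb X b) x y ≤ (Tl P f ^ n) 1 x y := by
        refine Tn_mono_pos S (fun x' y' hy' => ?_) n hn x y
        unfold Hb
        split_ifs with h <;> simp
      have h3 := shift 0 b (by ring) (by rw [abs_of_nonneg hb]; exact (not_le.1 hbL).le)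
      linarith

lemma Ex_surv (n : ℕ) (x : X) (y : ℝ) :
    Ex P x n (fun ω => ind (survives f y n ω)) = (Tl P f ^ n) 1 x y := by
  rw [Tl_pow_apply, ← Ex_eq_Q]
  simp

lemma Ex_le (n : ℕ) (x : X) (y a : ℝ) :
    Ex P x n (fun ω => ind (y + Spath f ω n ≤ a ∧ survives f y n ω)) =
      (Tl P f ^ n) 1 x y - (Tl P f ^ n) (Hb X a) x y := by
  have e : (Tl P f ^ n) 1 x y - (Tl P f ^ n) (Hb X a) x y = (Tl P f ^ n) (1 - Hb X a) x y := by
    rw [map_sub]; rfl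
  rw [e, Tl_pow_apply, ← Ex_eq_Q]
  congr 1
  funext ω
  simp only [ind, Hb, Pi.sub_apply, Pi.one_apply]
  by_cases h1 : y + Spath f ω n ≤ a
  · by_cases h2 : survives f y n ω
    · simp [h1, h2, not_lt.2 h1]
    · simp [h2]
  · simp [h1, not_le.1 h1]

lemma far_zero (S : Setup P f r ρ σ2 K) (H : X → ℝ → ℝ) (n : ℕ) (hn : 1 ≤ n) (x : X) (y : ℝ)
    (hy : y < -K) : (Tl P f ^ n) H x y = 0 := by
  obtain ⟨k, rfl⟩ : ∃ k, n = k + 1 := ⟨n - 1, by omega⟩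
  rw [Tl_pow_apply, Function.iterate_succ_apply']
  unfold Qop
  refine Finset.sum_eq_zero fun x' _ => ?_
  rw [if_neg, mul_zero]
  have := (abs_le.1 (S.fK x')).2
  linarith

lemma pp_level (hσ : 0 < σ2) (n : ℕ) (hn : 1 ≤ n) (t : ℝ) :
    pp σ2 n (t * Real.sqrt σ2 * Real.sqrt n) = Real.exp (-t ^ 2 / 2) * pp σ2 n 0 := by
  have hn' : (1:ℝ) ≤ n := by exact_mod_cast hn
  unfold pp
  have : -(t * Real.sqrt σ2 * Real.sqrt n) ^ 2 / (2 * (n * σ2)) = -t ^ 2 / 2 := by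
    rw [mul_pow, mul_pow, Real.sq_sqrt hσ.le, Real.sq_sqrt (by positivity)]
    field_simp
  rw [this]
  simp [div_eq_mul_inv]

lemma sn_eq (n : ℕ) : Real.sqrt σ2 * Real.sqrt (2 * π * n) / 2 =
    Real.sqrt σ2 * Real.sqrt (2 * π) / 2 * qq n ^ 8 := by
  rw [Real.sqrt_mul (by positivity), qq_sqrt]; ring

lemma qq_inv_tendsto (c : ℝ) : Tendsto (fun n => c / qq n) atTop (𝓝 0) := by
  refine Tendsto.const_div_atTop ?_ c
  unfold qq
  exact (tendsto_rpow_atTop (by norm_num)).comp tendsto_natCast_atTop_atTop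

lemma core (S : Setup P f r ρ σ2 K) (V : X → ℝ → ℝ)
    (hV : ∀ (x : X) (y : ℝ),
      Tendsto (fun n : ℕ => Real.sqrt σ2 * Real.sqrt (2 * π * n) / 2 *
            Ex P x n (fun ω => ind (survives f y n ω))) atTop (nhds (V x y))) :
    ∃ C : ℝ, 1 ≤ C ∧ ∀ n : ℕ, 1 ≤ n → ∀ t : ℝ, 0 ≤ t → ∀ (x : X) (y : ℝ),
      |Ex P x n (fun ω => ind (y + Spath f ω n ≤ t * Real.sqrt σ2 * Real.sqrt n ∧
              survives f y n ω)) -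
          2 * V x y / (Real.sqrt σ2 * Real.sqrt (2 * π * n)) * (1 - Real.exp (-t ^ 2 / 2))| ≤
        C * EE y / qq n ^ 9 := by
  have hσ := S.hσ
  have hK := S.hK
  obtain ⟨C1, hC1, hmain⟩ := main_bound S
  obtain ⟨C2, hC2, -, hcr⟩ := crude S
  set c := 1 / (Real.sqrt σ2 * Real.sqrt (2 * π)) with hc
  have hc0 : 0 ≤ c := by positivity
  have hp0 : ∀ n, pp σ2 n 0 = c * (1 / qq n ^ 8) := fun n => by rw [pp_zero, qq_sqrt]
  refine ⟨2 * C1 + 24 * c * K * C2, ?_, ?_⟩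
  · have : 0 ≤ 24 * c * K * C2 := by positivity
    linarith
  intro n hn t ht x y
  have hq := qq_one_le n hn
  have hq0 : 0 < qq n := by linarith
  have hE0 : 0 ≤ EE y := by linarith [EE_one y]
  have hVpp : 2 * V x y / (Real.sqrt σ2 * Real.sqrt (2 * π * n)) = 2 * pp σ2 n 0 * V x y := by
    rw [hp0, Real.sqrt_mul (by positivity), ← qq_sqrt, hc]
    ring
  rw [Ex_le, hVpp]
  simp_rw [Ex_surv] at hV
  by_cases hy : y < -K
  · have v0 : V x y = 0 := by
      refine tendsto_nhds_unique (hV x y) (tendsto_const_nhds.congr' ?_)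
      filter_upwards [eventually_ge_atTop 1] with m hm
      rw [far_zero S 1 m hm x y hy, mul_zero]
    rw [far_zero S 1 n hn x y hy, far_zero S _ n hn x y hy, v0]
    simp only [sub_zero, mul_zero, zero_mul, abs_zero]
    positivity
  rw [not_lt] at hy
  have hone : ∀ m, 1 ≤ m → (Tl P f ^ m) 1 x y = (Tl P f ^ m) (Hb X 0) x y := by
    intro m hm
    apply le_antisymm
    · exact Tn_mono_pos S (fun x' y' hy' => by simp [Hb, hy']) m hm x y
    · exact Tn_mono_pos S (fun x' y' hy' => by simp [Hb, hy']) m hm x y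
  -- convergence of the martingale part
  have hDlim : Tendsto (fun m => (Tl P f ^ m) (zet r) x y) atTop (𝓝 (V x y)) := by
    have hdiff : Tendsto (fun m : ℕ => Real.sqrt σ2 * Real.sqrt (2 * π * m) / 2 * (Tl P f ^ m) 1 x y
        - (Tl P f ^ m) (zet r) x y) atTop (𝓝 0) := by
      refine squeeze_zero_norm' ?_
        (qq_inv_tendsto (Real.sqrt σ2 * Real.sqrt (2 * π) / 2 * C1 * EE y))
      filter_upwards [eventually_ge_atTop 1] with m hm
      have hqm := qq_one_le m hm
      have h := hmain 0 m x y le_rfl hm hy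
      rw [← hone m hm, hp0] at h
      rw [sn_eq, Real.norm_eq_abs]
      set s := Real.sqrt σ2 * Real.sqrt (2 * π) with hs
      have hs0 : 0 < s := by positivity
      have e : s / 2 * qq m ^ 8 * (Tl P f ^ m) 1 x y - (Tl P f ^ m) (zet r) x y =
        s / 2 * qq m ^ 8 * ((Tl P f ^ m) 1 x y - 2 * (c * (1 / qq m ^ 8)) * (Tl P f ^ m) (zet r) x y) := by
        rw [hc]; field_simp
      rw [e, abs_mul, abs_of_pos (by positivity)]
      calc _ ≤ s / 2 * qq m ^ 8 * (C1 * EE y / qq m ^ 9) := by gcongr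
        _ = _ := by field_simp
    have := (hV x y).sub hdiff
    simpa using this
  have hDV : |(Tl P f ^ n) (zet r) x y - V x y| ≤ 6 * K * C2 * EE y * (1 / qq n ^ 8) := by
    have hl : Tendsto (fun m => |(Tl P f ^ n) (zet r) x y - (Tl P f ^ m) (zet r) x y|) atTop
      (𝓝 |(Tl P f ^ n) (zet r) x y - V x y|) := (tendsto_const_nhds.sub hDlim).abs
    refine le_of_tendsto hl ?_
    filter_upwards [eventually_ge_atTop n] with m hm
    have h1 := D_diff S hm x y hy
    have h2 := Tn_one_nonneg S m x y hy
    have h3 := hcr n x y hn hy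
    rw [qq_sqrt] at h3
    have h4 := EE_lin y
    calc _ ≤ 3 * K * ((Tl P f ^ n) 1 x y - (Tl P f ^ m) 1 x y) := h1
      _ ≤ 3 * K * (C2 * (1 + max y 0) / qq n ^ 8) := by gcongr; linarith
      _ ≤ 3 * K * (C2 * (2 * EE y) / qq n ^ 8) := by gcongr
      _ = _ := by ring
  have hG : ∀ b, 0 ≤ b → |(Tl P f ^ n) (Hb X b) x y - 2 * pp σ2 n b * V x y| ≤
      (C1 + 12 * c * K * C2) * EE y / qq n ^ 9 := by
    intro b hb
    have h1 := hmain b n x y hb hn hy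
    have h2 : |2 * pp σ2 n b * ((Tl P f ^ n) (zet r) x y - V x y)| ≤
        12 * c * K * C2 * EE y / qq n ^ 9 := by
      rw [abs_mul, abs_of_nonneg (mul_nonneg two_pos.le (pp_nonneg σ2 n b))]
      have h3 := pp_le_zero σ2 hσ n b
      rw [hp0] at h3
      have h4 : 1 / qq n ^ 16 ≤ 1 / qq n ^ 9 := by
        apply one_div_le_one_div_of_le (by positivity)
        exact pow_le_pow_right₀ hq (by norm_num)
      calc _ ≤ 2 * (c * (1 / qq n ^ 8)) * (6 * K * C2 * EE y * (1 / qq n ^ 8)) := by gcongr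
        _ = 12 * c * K * C2 * EE y * (1 / qq n ^ 16) := by field_simp; ring
        _ ≤ 12 * c * K * C2 * EE y * (1 / qq n ^ 9) := by gcongr
        _ = _ := by ring
    calc _ = |((Tl P f ^ n) (Hb X b) x y - 2 * pp σ2 n b * (Tl P f ^ n) (zet r) x y) +
          2 * pp σ2 n b * ((Tl P f ^ n) (zet r) x y - V x y)| := by congr 1; ring
      _ ≤ _ := abs_add_le _ _
      _ ≤ C1 * EE y / qq n ^ 9 + 12 * c * K * C2 * EE y / qq n ^ 9 := add_le_add h1 h2
      _ = _ := by ring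
  rw [hone n hn]
  have g0 := hG 0 le_rfl
  have ga := hG (t * Real.sqrt σ2 * Real.sqrt n) (by positivity)
  rw [pp_level hσ n hn] at ga
  calc _ = |((Tl P f ^ n) (Hb X 0) x y - 2 * pp σ2 n 0 * V x y) -
        ((Tl P f ^ n) (Hb X (t * Real.sqrt σ2 * Real.sqrt n)) x y -
          2 * (Real.exp (-t ^ 2 / 2) * pp σ2 n 0) * V x y)| := by congr 1; ring
    _ ≤ _ := abs_sub _ _
    _ ≤ _ := add_le_add g0 ga
    _ = _ := by ring

end

theorem final [Fintype X] [DecidableEq X] [Nonempty X]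
    (P : X → X → ℝ) (ν f : X → ℝ) (hS : IsStochastic P ν)
    (h1 : Primitive P) (h2 : ∑ x, f x * ν x = 0) (h3 : NonLattice P f)
    (V : X → ℝ → ℝ)
    (hV : ∀ (x : X) (y : ℝ),
      Tendsto (fun n : ℕ =>
          Real.sqrt (sigma2 P ν f) * Real.sqrt (2 * π * n) / 2 *
            Ex P x n (fun ω => ind (survives f y n ω)))
        atTop (nhds (V x y))) :
    (∀ (x : X) (y : ℝ), 0 < V x y → ∀ t : ℝ, 0 ≤ t →
      Tendsto (fun n : ℕ =>
          Ex P x n (fun ω =>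
              ind (y + Spath f ω n ≤ t * Real.sqrt (sigma2 P ν f) * Real.sqrt n ∧
                survives f y n ω)) /
            Ex P x n (fun ω => ind (survives f y n ω)))
        atTop (nhds (1 - Real.exp (-t ^ 2 / 2)))) ∧
    (∃ ε₀ > 0, ∀ ε ∈ Set.Ioo (0 : ℝ) ε₀, ∀ t₀ : ℝ, 0 < t₀ → ∃ c > 0,
      ∀ n : ℕ, 1 ≤ n → ∀ t ∈ Set.Icc (0 : ℝ) t₀, ∀ (x : X) (y : ℝ),
        |Ex P x n (fun ω =>
            ind (y + Spath f ω n ≤ t * Real.sqrt (sigma2 P ν f) * Real.sqrt n ∧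
              survives f y n ω)) -
          2 * V x y / (Real.sqrt (sigma2 P ν f) * Real.sqrt (2 * π * n)) *
            (1 - Real.exp (-t ^ 2 / 2))| ≤
        c * (1 + max y 0 ^ 2) / (n : ℝ) ^ ((1 : ℝ) / 2 + ε)) := by
  obtain ⟨r, ρ, K, S⟩ := exists_setup P ν f hS h1 h2 h3
  have hσ := S.hσ
  obtain ⟨C, hC, hcore⟩ := core S V hV
  constructor
  · intro x y hVp t ht
    set s := Real.sqrt (sigma2 P ν f) * Real.sqrt (2 * π) with hs
    have hs0 : 0 < s := by positivity
    have hb : Tendsto (fun n : ℕ => Real.sqrt (sigma2 P ν f) * Real.sqrt (2 * π * n) / 2 *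
        Ex P x n (fun ω =>
              ind (y + Spath f ω n ≤ t * Real.sqrt (sigma2 P ν f) * Real.sqrt n ∧
                survives f y n ω))) atTop (𝓝 (V x y * (1 - Real.exp (-t ^ 2 / 2)))) := by
      rw [tendsto_iff_norm_sub_tendsto_zero]
      refine squeeze_zero' (Eventually.of_forall fun n => norm_nonneg _) ?_
        (qq_inv_tendsto (s / 2 * C * EE y))
      filter_upwards [eventually_ge_atTop 1] with n hn
      have hqn := qq_one_le n hn
      have h := hcore n hn t ht x y
      have e1 : Real.sqrt (sigma2 P ν f) * Real.sqrt (2 * π * n) = s * qq n ^ 8 := by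
        have := sn_eq (σ2 := sigma2 P ν f) n
        rw [← hs] at this
        linarith
      rw [e1] at h ⊢
      rw [Real.norm_eq_abs]
      set A := Ex P x n (fun ω =>
              ind (y + Spath f ω n ≤ t * Real.sqrt (sigma2 P ν f) * Real.sqrt n ∧
                survives f y n ω))
      have e : s * qq n ^ 8 / 2 * A - V x y * (1 - Real.exp (-t ^ 2 / 2)) =
        s * qq n ^ 8 / 2 * (A - 2 * V x y / (s * qq n ^ 8) * (1 - Real.exp (-t ^ 2 / 2))) := by
        field_simp
      rw [e, abs_mul, abs_of_pos (by positivity)]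
      calc _ ≤ s * qq n ^ 8 / 2 * (C * EE y / qq n ^ 9) := by gcongr
        _ = _ := by field_simp
    have hd := hb.div (hV x y) hVp.ne'
    rw [mul_div_cancel_left₀ _ hVp.ne'] at hd
    refine hd.congr' ?_
    filter_upwards [eventually_ge_atTop 1] with n hn
    have hn' : (1:ℝ) ≤ n := by exact_mod_cast hn
    have : Real.sqrt (sigma2 P ν f) * Real.sqrt (2 * π * n) / 2 ≠ 0 := by positivity
    exact mul_div_mul_left _ _ this
  · refine ⟨1 / 16, by norm_num, fun ε hε t₀ ht₀ => ⟨C, by linarith, ?_⟩⟩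
    intro n hn t ht x y
    refine (hcore n hn t ht.1 x y).trans ?_
    have hn' : (1:ℝ) ≤ n := by exact_mod_cast hn
    have hq9 : qq n ^ 9 = (n : ℝ) ^ ((9:ℝ) / 16) := by
      unfold qq
      rw [← Real.rpow_natCast, ← Real.rpow_mul (by positivity)]
      norm_num
    rw [hq9]
    have : (n : ℝ) ^ ((1:ℝ) / 2 + ε) ≤ (n : ℝ) ^ ((9:ℝ) / 16) :=
      Real.rpow_le_rpow_of_exponent_le hn' (by linarith [hε.2])
    have hE0 := EE_one y
    unfold EE at hE0 ⊢
    gcongr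


/-- Proposition 2.3: conditioned integral limit theorem. -/
theorem conditioned_integral_limit_theorem [Fintype X] [DecidableEq X] [Nonempty X]
    (P : X → X → ℝ) (ν f : X → ℝ) (hS : IsStochastic P ν)
    (h1 : Primitive P) (h2 : ∑ x, f x * ν x = 0) (h3 : NonLattice P f)
    (V : X → ℝ → ℝ)
    (hV : ∀ (x : X) (y : ℝ),
      Tendsto (fun n : ℕ =>
          Real.sqrt (sigma2 P ν f) * Real.sqrt (2 * π * n) / 2 *
            Ex P x n (fun ω => ind (survives f y n ω)))
        atTop (nhds (V x y))) :
    (∀ (x : X) (y : ℝ), 0 < V x y → ∀ t : ℝ, 0 ≤ t →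
      Tendsto (fun n : ℕ =>
          Ex P x n (fun ω =>
              ind (y + Spath f ω n ≤ t * Real.sqrt (sigma2 P ν f) * Real.sqrt n ∧
                survives f y n ω)) /
            Ex P x n (fun ω => ind (survives f y n ω)))
        atTop (nhds (1 - Real.exp (-t ^ 2 / 2)))) ∧
    (∃ ε₀ > 0, ∀ ε ∈ Set.Ioo (0 : ℝ) ε₀, ∀ t₀ : ℝ, 0 < t₀ → ∃ c > 0,
      ∀ n : ℕ, 1 ≤ n → ∀ t ∈ Set.Icc (0 : ℝ) t₀, ∀ (x : X) (y : ℝ),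
        |Ex P x n (fun ω =>
            ind (y + Spath f ω n ≤ t * Real.sqrt (sigma2 P ν f) * Real.sqrt n ∧
              survives f y n ω)) -
          2 * V x y / (Real.sqrt (sigma2 P ν f) * Real.sqrt (2 * π * n)) *
            (1 - Real.exp (-t ^ 2 / 2))| ≤
        c * (1 + max y 0 ^ 2) / (n : ℝ) ^ ((1 : ℝ) / 2 + ε)) := by
  exact final P ν f hS h1 h2 h3 V hV
end CLLT
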